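/- arXiv:2007.10886 — 8 statements merged into one kernel-verified Lean document; each statement's English description precedes it below -/
import Mathlib

section
/- Determinantal identity (Theorem 1.2). Let N ≥ 1, let q, s_0 ∈ ℂ, let γ, ξ_0 ∈ ℂ∖{0}, and let u_1,…,u_N be nonzero complex numbers and v_1,…,v_N be pairwise distinct complex numbers such that u_iv_j ≠ 1 and qu_iv_j ≠ 1 for all 1 ≤ i,j ≤ N. Then [∏_{i,j=1}^N(1−qu_iv_j) / ∏_{1≤i<j≤N}(v_i−v_j)] · det_{1≤i,j≤N}[ ((1−γ)(q−γ^{−1}s_0²)(1−u_iv_j) + (1−q)(1−ξ_0s_0u_i)(1−ξ_0^{−1}s_0v_j)) / ((1−u_iv_j)(1−qu_iv_j)) ] = det_{1≤i,j≤N}[ u_j^{N−i−1} ( (1−s_0ξ_0u_j)(u_j−s_0/ξ_0) ∏_{l=1}^N (1−qu_jv_l)/(1−u_jv_l) − γ^{−1}q^{N−i}(γ−s_0ξ_0u_j)(γqu_j−s_0/ξ_0) ) ]. -/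
open scoped BigOperators

noncomputable section

/-- The Vandermonde-type product `∏_{1 ≤ i < j ≤ N} (w i − w j)`. -/
def vandP {N : ℕ} (w : Fin N → ℂ) : ℂ :=
  ∏ p ∈ Finset.univ.filter (fun p : Fin N × Fin N => p.1 < p.2), (w p.1 - w p.2)

open Polynomial in
/-- The coefficients of `∏ (X - v l)` are those of `∏ (1 - x v l)` in reversed order. -/
lemma sum_coeff_prod_X_sub_C_mul_pow {ι R : Type*} [Field R] (s : Finset ι) (v : ι → R)
    {N : ℕ} (hs : s.card + 1 = N) (x : R) :
    ∑ i : Fin N, (∏ l ∈ s, (X - C (v l))).coeff i * x ^ (N - 1 - (i : ℕ))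
      = ∏ l ∈ s, (1 - x * v l) := by
  subst hs
  have hdeg : (∏ l ∈ s, (X - C (v l))).natDegree = s.card := natDegree_finsetProd_X_sub_C_eq_card s v
  have hmonic : (∏ l ∈ s, (X - C (v l))).Monic := monic_prod_X_sub_C v s
  refine (Finset.sum_range fun i : ℕ =>
    (∏ l ∈ s, (X - C (v l))).coeff i * x ^ (s.card + 1 - 1 - i)).symm.trans ?_
  rcases eq_or_ne x 0 with rfl | hx
  · rw [Finset.sum_range_succ, Finset.sum_eq_zero]
    · have h := hmonic.coeff_natDegree
      rw [hdeg] at h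
      simp [h]
    · intro i hi
      have hi' := Finset.mem_range.mp hi
      rw [zero_pow (by omega), mul_zero]
  · have hprod : ∏ l ∈ s, (1 - x * v l)
        = x ^ s.card * (∏ l ∈ s, (X - C (v l))).eval x⁻¹ := by
      rw [eval_prod, ← Finset.prod_const, ← Finset.prod_mul_distrib]
      refine Finset.prod_congr rfl fun l _ => ?_
      simp [mul_sub, hx]
    rw [hprod, eval_eq_sum_range, hdeg, Finset.mul_sum]
    refine Finset.sum_congr rfl fun i hi => ?_
    have hi' : i ≤ s.card := Nat.lt_succ_iff.mp (Finset.mem_range.mp hi)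
    rw [Nat.add_sub_cancel, pow_sub₀ x hx hi', inv_pow]
    ring

lemma vandP_ne_zero {N : ℕ} {v : Fin N → ℂ} (hv : Function.Injective v) : vandP v ≠ 0 := by
  refine Finset.prod_ne_zero_iff.mpr fun p hp => sub_ne_zero.mpr fun h => ?_
  exact (Finset.mem_filter.mp hp).2.ne (hv h)

lemma prod_prod_erase_sub_eq_vandP_mul_det {N : ℕ} (v : Fin N → ℂ) :
    ∏ k, ∏ l ∈ Finset.univ.erase k, (v k - v l)
      = vandP v * (Matrix.vandermonde v).det := by
  have hlt : vandP v = ∏ k, ∏ l, if k < l then v k - v l else 1 := by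
    rw [vandP, Finset.prod_filter, Fintype.prod_prod_type]
  have hgt : (Matrix.vandermonde v).det = ∏ k, ∏ l, if l < k then v k - v l else 1 := by
    rw [Matrix.det_vandermonde, Finset.prod_comm]
    refine Finset.prod_congr rfl fun k _ => ?_
    rw [← Finset.prod_filter]
    refine Finset.prod_congr ?_ fun _ _ => rfl
    ext; simp
  rw [hlt, hgt, ← Finset.prod_mul_distrib]
  refine Finset.prod_congr rfl fun k _ => ?_
  rw [← Finset.prod_mul_distrib, ← Finset.filter_ne', Finset.prod_filter]
  refine Finset.prod_congr rfl fun l _ => ?_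
  rcases lt_trichotomy k l with h | rfl | h
  · simp [h, h.ne', h.not_gt]
  · simp
  · simp [h, h.ne, h.not_gt]

open Polynomial in
lemma det_coeff_prod_erase_X_sub_C {N : ℕ} {v : Fin N → ℂ} (hv : Function.Injective v) :
    (Matrix.of fun k i : Fin N => (∏ l ∈ Finset.univ.erase k, (X - C (v l))).coeff i).det
      = vandP v := by
  refine mul_right_cancel₀ (Matrix.det_vandermonde_ne_zero_iff.mpr hv) ?_
  rw [← prod_prod_erase_sub_eq_vandP_mul_det, ← Matrix.det_diagonal,
    ← Matrix.det_transpose (Matrix.vandermonde v), ← Matrix.det_mul]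
  congr 1
  ext k j
  have hdeg : (∏ l ∈ Finset.univ.erase k, (X - C (v l))).natDegree < N := by
    rw [natDegree_finsetProd_X_sub_C_eq_card, Finset.card_erase_of_mem (Finset.mem_univ k),
      Finset.card_univ, Fintype.card_fin]
    exact Nat.sub_lt k.pos one_pos
  have heval := eval_eq_sum_range' hdeg (v j)
  rw [Finset.sum_range] at heval
  simp only [Matrix.mul_apply, Matrix.of_apply, Matrix.transpose_apply, Matrix.vandermonde_apply]
  rw [← heval, eval_prod]
  simp only [eval_sub, eval_X, eval_C]
  rcases eq_or_ne k j with rfl | h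
  · simp
  · rw [Matrix.diagonal_apply_ne _ h]
    exact Finset.prod_eq_zero (Finset.mem_erase.mpr ⟨h.symm, Finset.mem_univ j⟩) (sub_self _)

/-- Determinantal identity (Theorem 1.2). -/
theorem determinantal_identity
    (N : ℕ) (hN : 1 ≤ N) (q s0 : ℂ) (γ ξ0 : ℂ) (hγ : γ ≠ 0) (hξ : ξ0 ≠ 0)
    (u v : Fin N → ℂ) (hu0 : ∀ j, u j ≠ 0) (hv : Function.Injective v)
    (huv : ∀ i j : Fin N, u i * v j ≠ 1) (hquv : ∀ i j : Fin N, q * u i * v j ≠ 1) :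
    ((∏ i : Fin N, ∏ j : Fin N, (1 - q * u i * v j)) / vandP v)
      * Matrix.det (Matrix.of fun i j : Fin N =>
          ((1 - γ) * (q - γ⁻¹ * s0 ^ 2) * (1 - u i * v j)
              + (1 - q) * (1 - ξ0 * s0 * u i) * (1 - ξ0⁻¹ * s0 * v j))
            / ((1 - u i * v j) * (1 - q * u i * v j)))
    = Matrix.det (Matrix.of fun i j : Fin N =>
        u j ^ ((N : ℤ) - (i : ℕ) - 2)
          * ((1 - s0 * ξ0 * u j) * (u j - s0 / ξ0)
                * ∏ l : Fin N, (1 - q * u j * v l) / (1 - u j * v l)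
              - γ⁻¹ * q ^ (N - 1 - (i : ℕ)) * (γ - s0 * ξ0 * u j)
                * (γ * q * u j - s0 / ξ0))) := by
  rw [div_mul_eq_mul_div, div_eq_iff (vandP_ne_zero hv), mul_comm (Matrix.det _) (vandP v),
    ← det_coeff_prod_erase_X_sub_C hv, ← Matrix.det_mul, ← Matrix.det_mul_column,
    ← Matrix.det_transpose]
  congr 1
  ext k j
  simp only [Matrix.mul_apply, Matrix.of_apply, Matrix.transpose_apply]
  have hcard : (Finset.univ.erase k).card + 1 = N := by
    rw [Finset.card_erase_add_one (Finset.mem_univ k), Finset.card_univ, Fintype.card_fin]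
  have hu := hu0 j
  have hsub (w : Fin N) : 1 - u j * v w ≠ 0 := sub_ne_zero.mpr (huv j w).symm
  have hqsub (w : Fin N) : 1 - q * u j * v w ≠ 0 := sub_ne_zero.mpr (hquv j w).symm
  have hden : ∏ l ∈ Finset.univ.erase k, (1 - u j * v l) ≠ 0 :=
    Finset.prod_ne_zero_iff.mpr fun l _ => hsub l
  have hsum := sum_coeff_prod_X_sub_C_mul_pow (Finset.univ.erase k) v hcard (u j)
  have hqsum := sum_coeff_prod_X_sub_C_mul_pow (Finset.univ.erase k) v hcard (q * u j)
  have hzpow (i : Fin N) : u j ^ ((N : ℤ) - (i : ℕ) - 2) = u j ^ (N - 1 - (i : ℕ)) * (u j)⁻¹ := by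
    rw [← zpow_natCast, ← zpow_sub_one₀ hu]
    congr 1
    have := i.isLt
    omega
  set F := ∏ l : Fin N, (1 - q * u j * v l) / (1 - u j * v l) with hF
  set Q := fun i : Fin N =>
    (∏ l ∈ Finset.univ.erase k, (Polynomial.X - Polynomial.C (v l))).coeff (i : ℕ)
  have hsplit : ∑ i : Fin N, Q i * (u j ^ ((N : ℤ) - (i : ℕ) - 2)
        * ((1 - s0 * ξ0 * u j) * (u j - s0 / ξ0) * F
            - γ⁻¹ * q ^ (N - 1 - (i : ℕ)) * (γ - s0 * ξ0 * u j) * (γ * q * u j - s0 / ξ0)))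
      = (u j)⁻¹ * ((1 - s0 * ξ0 * u j) * (u j - s0 / ξ0) * F
            * ∏ l ∈ Finset.univ.erase k, (1 - u j * v l)
          - γ⁻¹ * (γ - s0 * ξ0 * u j) * (γ * q * u j - s0 / ξ0)
            * ∏ l ∈ Finset.univ.erase k, (1 - q * u j * v l)) := by
    rw [← hsum, ← hqsum, Finset.mul_sum, Finset.mul_sum, ← Finset.sum_sub_distrib, Finset.mul_sum]
    refine Finset.sum_congr rfl fun i _ => ?_
    rw [hzpow, mul_pow]
    ring
  refine Eq.trans ?_ hsplit.symm
  rw [hF, Finset.prod_div_distrib, ← Finset.mul_prod_erase _ _ (Finset.mem_univ k),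
    ← Finset.mul_prod_erase _ (fun l => 1 - u j * v l) (Finset.mem_univ k)]
  have hk := hsub k
  have hqk := hqsub k
  field_simp
  ring
end
end

section
/- Uniqueness via Lagrange interpolation (Lemma 3.5). For each N ≥ 1 let f_N(u_1,…,u_N) and g_N(u_1,…,u_N) be symmetric polynomials over ℂ in N variables whose degree in each individual variable is at most N. Suppose that for each N ≥ 2 there are pairwise distinct points t^{(N)}_1,…,t^{(N)}_N ∈ ℂ, constants C^{(1)}_N,…,C^{(N)}_N ∈ ℂ, a point (u^0_1,…,u^0_N) ∈ ℂ^N with u^0_l ∉ {t^{(N)}_1,…,t^{(N)}_N} for every 1 ≤ l ≤ N, and a constant C^{(0)}_N, such that for all 1 ≤ i ≤ N one has f_N(u_1,…,u_{N−1},t^{(N)}_i) = C^{(i)}_N·f_{N−1}(u_1,…,u_{N−1}) and g_N(u_1,…,u_{N−1},t^{(N)}_i) = C^{(i)}_N·g_{N−1}(u_1,…,u_{N−1}) identically in u_1,…,u_{N−1}, and moreover f_N(u^0_1,…,u^0_N) = C^{(0)}_N = g_N(u^0_1,…,u^0_N). If f_1 = g_1, then f_N = g_N for every N ≥ 1. 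-/
open scoped BigOperators

noncomputable section

/-- Restricting a multivariate polynomial to the line through `x` in the direction of the
coordinate `l` gives a univariate polynomial of degree at most `P.degreeOf l`. -/
theorem MvPolynomial.natDegree_aeval_update_C_le {R σ : Type*} [CommSemiring R] [DecidableEq σ]
    (P : MvPolynomial σ R) (x : σ → R) (l : σ) :
    (MvPolynomial.aeval (Function.update (fun j => Polynomial.C (x j)) l Polynomial.X) P).natDegree
      ≤ P.degreeOf l := by
  rw [MvPolynomial.aeval_def, MvPolynomial.eval₂_eq]
  refine Polynomial.natDegree_sum_le_of_forall_le _ _ fun m hm => ?_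
  refine (Polynomial.natDegree_C_mul_le _ _).trans
    ((Polynomial.natDegree_prod_le _ _).trans ?_)
  refine le_trans ?_ (MvPolynomial.monomial_le_degreeOf l hm)
  have hterm : ∀ j ∈ m.support,
      (Function.update (fun j => Polynomial.C (x j)) l Polynomial.X j ^ m j).natDegree
        ≤ if j = l then m l else 0 := by
    intro j _
    by_cases hj : j = l
    · subst hj
      simpa using Polynomial.natDegree_X_pow_le (R := R) (m j)
    · rw [Function.update_of_ne hj, if_neg hj, ← Polynomial.C_pow, Polynomial.natDegree_C]
  refine (Finset.sum_le_sum hterm).trans ?_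
  rw [Finset.sum_ite_eq']
  split_ifs <;> simp

theorem MvPolynomial.eval_aeval_update_C {R σ : Type*} [CommSemiring R] [DecidableEq σ]
    (P : MvPolynomial σ R) (x : σ → R) (l : σ) (z : R) :
    (MvPolynomial.aeval (Function.update (fun j => Polynomial.C (x j)) l Polynomial.X) P).eval z
      = MvPolynomial.eval (Function.update x l z) P := by
  rw [MvPolynomial.aeval_def, ← Polynomial.coe_evalRingHom, MvPolynomial.hom_eval₂,
    MvPolynomial.eval, MvPolynomial.coe_eval₂Hom]
  congr 1
  · ext; simp
  · ext j
    by_cases hj : j = l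
    · subst hj; simp
    · simp [hj]

/-- A polynomial of degree at most `n` in each variable that vanishes as soon as one coordinate
equals one of `n` distinct nodes, and that vanishes at a point none of whose coordinates is a node,
vanishes everywhere. -/
theorem MvPolynomial.eval_eq_zero_of_vanishing_at_nodes {R σ : Type*} [CommRing R] [IsDomain R]
    [Finite σ] {n : ℕ} (P : MvPolynomial σ R) (hdeg : ∀ l, P.degreeOf l ≤ n)
    {t : Fin n → R} (ht : Function.Injective t) {u : σ → R} (hu : ∀ l i, u l ≠ t i)
    (hnode : ∀ (x : σ → R) (l : σ) (i : Fin n), x l = t i → MvPolynomial.eval x P = 0)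
    (hP : MvPolynomial.eval u P = 0) (x : σ → R) : MvPolynomial.eval x P = 0 := by
  classical
  have := Fintype.ofFinite σ
  suffices h : ∀ (S : Finset σ) (x : σ → R), (∀ j ∉ S, x j = u j) → MvPolynomial.eval x P = 0 from
    h Finset.univ x (by simp)
  intro S
  induction S using Finset.induction_on with
  | empty =>
    intro x hx
    have hxu : x = u := _root_.funext fun j => hx j (by simp)
    rwa [hxu]
  | insert l S hl ih =>
    intro x hx
    have hzero := Polynomial.eq_zero_of_natDegree_lt_card_of_eval_eq_zero
      (MvPolynomial.aeval (Function.update (fun j => Polynomial.C (x j)) l Polynomial.X) P)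
      (f := (Fin.cons (u l) t : Fin (n + 1) → R))
      (Fin.cons_injective_iff.2 ⟨fun ⟨i, hi⟩ => hu l i hi.symm, ht⟩)
      (fun i => by
        rw [MvPolynomial.eval_aeval_update_C]
        refine Fin.cases ?_ (fun i => ?_) i
        · refine ih _ fun j hj => ?_
          by_cases hjl : j = l
          · subst hjl; simp
          · rw [Function.update_of_ne hjl]
            exact hx j (by simp [hjl, hj])
        · exact hnode _ l i (by simp))
      (by
        rw [Fintype.card_fin]
        exact Nat.lt_succ_of_le ((P.natDegree_aeval_update_C_le x l).trans (hdeg l)))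
    have heval := P.eval_aeval_update_C x l (x l)
    rw [hzero, Function.update_eq_self] at heval
    simpa using heval.symm

theorem MvPolynomial.IsSymmetric.eval_comp_perm {R σ : Type*} [CommSemiring R]
    {P : MvPolynomial σ R} (hP : P.IsSymmetric) (e : Equiv.Perm σ) (x : σ → R) :
    MvPolynomial.eval (x ∘ e) P = MvPolynomial.eval x P := by
  rw [← MvPolynomial.eval_rename, hP e]

/-- Uniqueness via Lagrange interpolation (Lemma 3.5). -/
theorem lagrange_interpolation_uniqueness
    (f g : (N : ℕ) → (Fin N → ℂ) → ℂ)
    (hfpoly : ∀ N : ℕ, 1 ≤ N → ∃ P : MvPolynomial (Fin N) ℂ,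
      P.IsSymmetric ∧ (∀ i : Fin N, P.degreeOf i ≤ N) ∧ ∀ x, MvPolynomial.eval x P = f N x)
    (hgpoly : ∀ N : ℕ, 1 ≤ N → ∃ P : MvPolynomial (Fin N) ℂ,
      P.IsSymmetric ∧ (∀ i : Fin N, P.degreeOf i ≤ N) ∧ ∀ x, MvPolynomial.eval x P = g N x)
    (hrec : ∀ N : ℕ, 1 ≤ N → ∃ (t C u0 : Fin (N + 1) → ℂ) (C0 : ℂ),
      Function.Injective t
      ∧ (∀ l i : Fin (N + 1), u0 l ≠ t i)
      ∧ (∀ (i : Fin (N + 1)) (x : Fin N → ℂ), f (N + 1) (Fin.snoc x (t i)) = C i * f N x)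
      ∧ (∀ (i : Fin (N + 1)) (x : Fin N → ℂ), g (N + 1) (Fin.snoc x (t i)) = C i * g N x)
      ∧ f (N + 1) u0 = C0 ∧ g (N + 1) u0 = C0)
    (h1 : f 1 = g 1) :
    ∀ N : ℕ, 1 ≤ N → f N = g N := by
  intro N hN
  induction N, hN using Nat.le_induction with
  | base => exact h1
  | succ N hN ih =>
    obtain ⟨P, hPs, hPd, hP⟩ := hfpoly (N + 1) (by omega)
    obtain ⟨Q, hQs, hQd, hQ⟩ := hgpoly (N + 1) (by omega)
    obtain ⟨t, C, u, c, ht, hu, hf, hg, hfu, hgu⟩ := hrec N hN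
    have hsymm : (P - Q).IsSymmetric := hPs.sub hQs
    have hzero := MvPolynomial.eval_eq_zero_of_vanishing_at_nodes (P - Q)
      (fun l => (MvPolynomial.degreeOf_sub_le l P Q).trans (max_le (hPd l) (hQd l))) ht hu
      (fun x l i hx => by
        rw [← hsymm.eval_comp_perm (Equiv.swap l (Fin.last N)) x]
        have hsnoc : x ∘ Equiv.swap l (Fin.last N)
            = Fin.snoc (Fin.init (x ∘ Equiv.swap l (Fin.last N))) (t i) := by
          conv_lhs => rw [← Fin.snoc_init_self (x ∘ Equiv.swap l (Fin.last N))]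
          simp [hx]
        rw [hsnoc, map_sub, hP, hQ, hf, hg, ih, sub_self])
      (by rw [map_sub, hP, hQ, hfu, hgu, sub_self])
    funext x
    rw [← hP, ← hQ, ← sub_eq_zero, ← map_sub, hzero]
end
end

section
/- Specialized determinant evaluation (Lemma 3.6). Let N ≥ 1 and let q, γ, s_0, ξ_0 ∈ ℂ with q ≠ 0 and s_0ξ_0γ ≠ 0; set u_0 = 1/(s_0ξ_0γ). Assume the points u_0, u_0q, …, u_0q^{N−1} are pairwise distinct, that v_1,…,v_N are pairwise distinct complex numbers, and that q^{i−1}u_0v_j ≠ 1 and q^{i}u_0v_j ≠ 1 for all 1 ≤ i,j ≤ N. Then [∏_{i,j=1}^N (1−q^{i−1}u_0v_j)(1−q^{i}u_0v_j)] / [∏_{1≤i<j≤N}(q^{i−1}u_0−q^{j−1}u_0)(v_i−v_j)] · det[z(q^{i−1}u_0, v_j)]_{i,j=1}^N = q^{N²} · ∏_{i,j=1}^N (1−v_iq^{j−1}/(s_0ξ_0γ)) · ∏_{j=1}^N (1−γq^{1−j})(1−s_0²γq^{−j}). -/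
open scoped BigOperators

noncomputable section

/-- The Izergin–Korepin type matrix element
`z(u,v) = [(1−γ)(q−γs₀²)(1−uv) + (1−q)(1−γξ₀s₀u)(1−γξ₀⁻¹s₀v)] / ((1−uv)(1−quv))`. -/
def zfun (q γ s0 ξ0 u v : ℂ) : ℂ :=
  ((1 - γ) * (q - γ * s0 ^ 2) * (1 - u * v)
      + (1 - q) * (1 - γ * ξ0 * s0 * u) * (1 - γ * ξ0⁻¹ * s0 * v))
    / ((1 - u * v) * (1 - q * u * v))

theorem vandP_eq_prod_Ioi {N : ℕ} (w : Fin N → ℂ) :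
    vandP w = ∏ i, ∏ j ∈ Finset.Ioi i, (w i - w j) := by
  unfold vandP
  exact Finset.prod_finset_product _ Finset.univ (fun i => Finset.Ioi i) (by simp)

/-- The Cauchy determinant: the determinant of the matrix with entries `1 / (1 - yᵢ xⱼ)`. -/
theorem det_one_sub_mul_inv {K : Type*} [Field K] {n : ℕ} (y x : Fin n → K)
    (h : ∀ i j, 1 - y i * x j ≠ 0) :
    (∏ i, ∏ j, (1 - y i * x j)) * (Matrix.of fun i j => (1 - y i * x j)⁻¹).det
      = ∏ i, ∏ j ∈ Finset.Ioi i, (y i - y j) * (x i - x j) := by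
  induction n with
  | zero => simp
  | succ n ih =>
    have hrow : (Matrix.of fun i j => (1 - y i * x j)⁻¹).det
        = (Matrix.of fun i j : Fin (n + 1) => (1 - y 0 * x j)⁻¹ *
            (Fin.cons 1 (fun k : Fin n => (y k.succ - y 0) * (x j / (1 - y k.succ * x j))) :
              Fin (n + 1) → K) i).det := by
      refine Matrix.det_eq_of_forall_row_eq_smul_add_const (Fin.cons 0 fun _ => 1) 0 rfl ?_
      intro i j
      refine Fin.cases ?_ (fun k => ?_) i
      · simp
      · simp only [Matrix.of_apply, Fin.cons_succ, Fin.cons_zero]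
        have h1 := h k.succ j
        have h2 : 1 - x j * y 0 ≠ 0 := by simpa only [mul_comm] using h 0 j
        field_simp
        ring
    have hfac := Matrix.det_mul_row (fun j => (1 - y 0 * x j)⁻¹)
      (Matrix.of fun i j : Fin (n + 1) =>
        (Fin.cons 1 (fun k : Fin n => (y k.succ - y 0) * (x j / (1 - y k.succ * x j))) :
          Fin (n + 1) → K) i)
    simp only [Matrix.of_apply] at hfac
    have hcol : (Matrix.of fun i j : Fin (n + 1) =>
            (Fin.cons 1 (fun k : Fin n => (y k.succ - y 0) * (x j / (1 - y k.succ * x j))) :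
              Fin (n + 1) → K) i).det
        = (Matrix.of fun i j : Fin (n + 1) =>
            (Fin.cons (if j = 0 then 1 else 0) (fun k : Fin n => (y k.succ - y 0) *
              (if j = 0 then x 0 / (1 - y k.succ * x 0) else
                (x j - x 0) / ((1 - y k.succ * x 0) * (1 - y k.succ * x j)))) :
              Fin (n + 1) → K) i).det := by
      rw [← Matrix.det_transpose, ← Matrix.det_transpose (Matrix.of _)]
      refine Matrix.det_eq_of_forall_row_eq_smul_add_const (Fin.cons 0 fun _ => 1) 0 rfl ?_
      intro j i
      refine Fin.cases ?_ (fun l => ?_) j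
      · refine Fin.cases ?_ (fun k => ?_) i <;> simp
      · refine Fin.cases ?_ (fun k => ?_) i
        · simp
        · have h1 := h k.succ l.succ
          have h2 := h k.succ 0
          simp only [Matrix.transpose_apply, Matrix.of_apply, Fin.cons_succ, Fin.succ_ne_zero,
            if_false, if_true]
          generalize x 0 = a at *
          generalize x l.succ = b at *
          field_simp
          ring
    have hexp : (Matrix.of fun i j : Fin (n + 1) =>
            (Fin.cons (if j = 0 then 1 else 0) (fun k : Fin n => (y k.succ - y 0) *
              (if j = 0 then x 0 / (1 - y k.succ * x 0) else
                (x j - x 0) / ((1 - y k.succ * x 0) * (1 - y k.succ * x j)))) :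
              Fin (n + 1) → K) i).det
        = (Matrix.of fun i j : Fin n => ((y i.succ - y 0) / (1 - y i.succ * x 0)) *
            ((Matrix.of fun i j : Fin n => (x j.succ - x 0) *
              (Matrix.of fun i j : Fin n => (1 - y i.succ * x j.succ)⁻¹) i j) i j)).det := by
      rw [Matrix.det_succ_row_zero, Fin.sum_univ_succ]
      simp only [Matrix.of_apply, Fin.cons_zero, Fin.succ_ne_zero, if_false, if_true,
        mul_zero, zero_mul, Finset.sum_const_zero, add_zero, Fin.val_zero, pow_zero, one_mul]
      congr 1
      ext i j
      have h1 := h i.succ j.succ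
      have h2 := h i.succ 0
      simp [Matrix.submatrix_apply, Fin.succAbove_zero, Fin.succ_ne_zero]
      field_simp
    have ih' := ih (fun i => y i.succ) (fun j => x j.succ) (fun i j => h _ _)
    rw [hrow, hfac, hcol, hexp, Matrix.det_mul_column, Matrix.det_mul_row]
    simp only [Fin.prod_univ_succ (n := n), Fin.prod_Ioi_zero, Fin.prod_Ioi_succ]
    rw [← ih']
    simp only [Finset.prod_mul_distrib, Finset.prod_div_distrib, Finset.prod_inv_distrib]
    have e1 : ∏ i : Fin n, (1 - y 0 * x i.succ) ≠ 0 := Finset.prod_ne_zero_iff.2 fun _ _ => h _ _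
    have e2 : ∏ i : Fin n, (1 - x 0 * y i.succ) ≠ 0 :=
      Finset.prod_ne_zero_iff.2 fun _ _ => by simpa only [mul_comm] using h _ 0
    have e3 := h 0 0
    have e4 : (∏ i : Fin n, (y i.succ - y 0)) * ∏ i : Fin n, (x i.succ - x 0)
        = (∏ i : Fin n, (y 0 - y i.succ)) * ∏ i : Fin n, (x 0 - x i.succ) := by
      simp only [← Finset.prod_mul_distrib]
      exact Finset.prod_congr rfl fun _ _ => by ring
    rw [← e4]
    field_simp

/-- A matrix whose rows combine consecutive rows of a sequence is a lower bidiagonal matrix times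
the matrix of those rows. -/
theorem det_consecutive_rows {K : Type*} [Field K] {n : ℕ} (c : ℕ → Fin n → K) (a b : ℕ → K)
    (ha : a 0 = 0) :
    (Matrix.of fun i j : Fin n => a i * c i j + b i * c (i + 1) j).det
      = (∏ i : Fin n, b i) * (Matrix.of fun i j : Fin n => c (i + 1) j).det := by
  let L : Matrix (Fin n) (Fin n) K := Matrix.of fun i k =>
    (if (k : ℕ) + 1 = i then a i else 0) + (if k = i then b i else 0)
  have hL : L.det = ∏ i : Fin n, b i := by
    rw [Matrix.det_of_isLowerTriangular L]
    · simp [L]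
    · intro i k hik
      have hik' : i < k := hik
      have h1 : ¬ (k : ℕ) + 1 = i := by have := Fin.lt_def.1 hik'; omega
      simp [L, h1, hik'.ne']
  rw [← hL, ← Matrix.det_mul]
  congr 1
  ext i j
  simp only [Matrix.mul_apply, L, Matrix.of_apply, add_mul, ite_mul, zero_mul,
    Finset.sum_add_distrib, Finset.sum_ite_eq', Finset.mem_univ, if_true]
  congr 1
  rcases i with ⟨_ | i, hi⟩
  · simp [ha]
  · rw [Finset.sum_eq_single ⟨i, by omega⟩]
    · simp
    · intro k _ hk
      rw [if_neg]
      intro h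
      exact hk (Fin.ext (by simpa using h))
    · simp

theorem zfun_eq_partial_fractions {q γ s0 ξ0 : ℂ} (hq : q ≠ 0) (h0 : s0 * ξ0 * γ ≠ 0) {v : ℂ}
    (i : ℕ) (h1 : 1 - q ^ i * (1 / (s0 * ξ0 * γ)) * v ≠ 0)
    (h2 : 1 - q ^ (i + 1) * (1 / (s0 * ξ0 * γ)) * v ≠ 0) :
    zfun q γ s0 ξ0 (q ^ i * (1 / (s0 * ξ0 * γ))) v
      = (1 - q ^ i) * (1 - γ ^ 2 * s0 ^ 2 / q ^ i) * (1 - q ^ i * (1 / (s0 * ξ0 * γ)) * v)⁻¹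
        + q ^ (i + 1) * ((1 - γ * q ^ (-(i : ℤ))) * (1 - s0 ^ 2 * γ * q ^ (-(i : ℤ) - 1)))
          * (1 - q ^ (i + 1) * (1 / (s0 * ξ0 * γ)) * v)⁻¹ := by
  have hqi : q ^ i ≠ 0 := pow_ne_zero _ hq
  have e1 : q ^ (-(i : ℤ)) = (q ^ i)⁻¹ := by rw [zpow_neg, zpow_natCast]
  have e2 : q ^ (-(i : ℤ) - 1) = (q ^ i)⁻¹ * q⁻¹ := by rw [zpow_sub_one₀ hq, e1]
  have e3 : γ * ξ0 * s0 * (q ^ i * (1 / (s0 * ξ0 * γ))) = q ^ i := by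
    rw [show γ * ξ0 * s0 = s0 * ξ0 * γ by ring, mul_left_comm, mul_one_div_cancel h0, mul_one]
  have hs : s0 ≠ 0 := fun h => h0 (by simp [h])
  have hξ : ξ0 ≠ 0 := fun h => h0 (by simp [h])
  have hγ : γ ≠ 0 := fun h => h0 (by simp [h])
  have e4 : γ * ξ0⁻¹ * s0 = γ ^ 2 * s0 ^ 2 * (1 / (s0 * ξ0 * γ)) := by field_simp
  have h3 : 1 - q * (q ^ i * (1 / (s0 * ξ0 * γ))) * v ≠ 0 := by
    rwa [← mul_assoc, ← pow_succ']
  unfold zfun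
  rw [e1, e2, e3, e4, pow_succ' q i]
  rw [pow_succ'] at h2
  generalize 1 / (s0 * ξ0 * γ) = u at *
  generalize q ^ i = Q at *
  rw [← mul_assoc] at h3
  rw [div_eq_iff (mul_ne_zero h1 (by rwa [← mul_assoc]))]
  have k1 : (1 - Q * u * v)⁻¹ * (1 - Q * u * v) = 1 := inv_mul_cancel₀ h1
  have k2 : (1 - q * Q * u * v)⁻¹ * (1 - q * Q * u * v) = 1 := inv_mul_cancel₀ h2
  have k3 : q * (Q * u) * v = q * Q * u * v := by ring
  rw [k3]
  generalize (1 - Q * u * v)⁻¹ = A at *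
  generalize (1 - q * Q * u * v)⁻¹ = B at *
  trans (1 - Q) * (1 - γ ^ 2 * s0 ^ 2 / Q) * (1 - q * Q * u * v) * (A * (1 - Q * u * v))
    + q * Q * ((1 - γ * Q⁻¹) * (1 - s0 ^ 2 * γ * (Q⁻¹ * q⁻¹))) * (1 - Q * u * v)
      * (B * (1 - q * Q * u * v))
  · rw [k1, k2]
    field_simp
    ring
  · ring

/-- Specialized determinant evaluation (Lemma 3.6). -/
theorem specialized_det_evaluation
    (N : ℕ) (hN : 1 ≤ N) (q γ s0 ξ0 : ℂ) (hq : q ≠ 0) (h0 : s0 * ξ0 * γ ≠ 0)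
    (u0 : ℂ) (hu0 : u0 = 1 / (s0 * ξ0 * γ))
    (hdist : Function.Injective (fun i : Fin N => q ^ (i : ℕ) * u0))
    (v : Fin N → ℂ) (hv : Function.Injective v)
    (h1 : ∀ i j : Fin N, q ^ (i : ℕ) * u0 * v j ≠ 1)
    (h2 : ∀ i j : Fin N, q ^ ((i : ℕ) + 1) * u0 * v j ≠ 1) :
    (∏ i : Fin N, ∏ j : Fin N,
        (1 - q ^ (i : ℕ) * u0 * v j) * (1 - q ^ ((i : ℕ) + 1) * u0 * v j))
      / ((vandP fun i : Fin N => q ^ (i : ℕ) * u0) * vandP v)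
      * Matrix.det (Matrix.of fun i j : Fin N => zfun q γ s0 ξ0 (q ^ (i : ℕ) * u0) (v j))
    = q ^ (N ^ 2)
        * (∏ i : Fin N, ∏ j : Fin N, (1 - v i * q ^ (j : ℕ) / (s0 * ξ0 * γ)))
        * ∏ j : Fin N,
            (1 - γ * q ^ (-((j : ℕ) : ℤ))) * (1 - s0 ^ 2 * γ * q ^ (-((j : ℕ) : ℤ) - 1)) := by
  have h1' : ∀ i j : Fin N, 1 - q ^ (i : ℕ) * u0 * v j ≠ 0 := fun i j =>
    sub_ne_zero.2 (h1 i j).symm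
  have h2' : ∀ i j : Fin N, 1 - q ^ ((i : ℕ) + 1) * u0 * v j ≠ 0 := fun i j =>
    sub_ne_zero.2 (h2 i j).symm
  have hVu : (vandP fun i : Fin N => q ^ (i : ℕ) * u0) ≠ 0 := by
    refine Finset.prod_ne_zero_iff.2 fun p hp => sub_ne_zero.2 fun h => ?_
    exact (Finset.mem_filter.1 hp).2.ne (hdist h)
  have hVv : vandP v ≠ 0 := by
    refine Finset.prod_ne_zero_iff.2 fun p hp => sub_ne_zero.2 fun h => ?_
    exact (Finset.mem_filter.1 hp).2.ne (hv h)
  have hdet : Matrix.det (Matrix.of fun i j : Fin N => zfun q γ s0 ξ0 (q ^ (i : ℕ) * u0) (v j))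
      = (∏ i : Fin N, q ^ ((i : ℕ) + 1) * ((1 - γ * q ^ (-((i : ℕ) : ℤ)))
          * (1 - s0 ^ 2 * γ * q ^ (-((i : ℕ) : ℤ) - 1))))
        * Matrix.det (Matrix.of fun i j : Fin N => (1 - q ^ ((i : ℕ) + 1) * u0 * v j)⁻¹) := by
    rw [← det_consecutive_rows (fun i j => (1 - q ^ i * u0 * v j)⁻¹)
      (fun i => (1 - q ^ i) * (1 - γ ^ 2 * s0 ^ 2 / q ^ i))
      (fun i => q ^ (i + 1) * ((1 - γ * q ^ (-(i : ℤ))) * (1 - s0 ^ 2 * γ * q ^ (-(i : ℤ) - 1))))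
      (by simp)]
    congr 1
    ext i j
    subst hu0
    exact zfun_eq_partial_fractions hq h0 i (h1' i j) (h2' i j)
  have hcauchy := det_one_sub_mul_inv (fun i : Fin N => q ^ ((i : ℕ) + 1) * u0) v h2'
  have hvand : ∏ i : Fin N, ∏ j ∈ Finset.Ioi i,
        (q ^ ((i : ℕ) + 1) * u0 - q ^ ((j : ℕ) + 1) * u0) * (v i - v j)
      = (∏ i : Fin N, q ^ (N - 1 - (i : ℕ)))
        * ((vandP fun i : Fin N => q ^ (i : ℕ) * u0) * vandP v) := by
    simp only [vandP_eq_prod_Ioi, ← Finset.prod_mul_distrib]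
    refine Finset.prod_congr rfl fun i _ => ?_
    rw [← Fin.card_Ioi, ← Finset.prod_const, ← Finset.prod_mul_distrib]
    exact Finset.prod_congr rfl fun j _ => by ring
  have hpow : (∏ i : Fin N, q ^ ((i : ℕ) + 1)) * ∏ i : Fin N, q ^ (N - 1 - (i : ℕ))
      = q ^ (N ^ 2) := by
    rw [← Finset.prod_mul_distrib, sq, pow_mul]
    refine (Finset.prod_congr rfl fun i _ => ?_).trans (Fin.prod_const N (q ^ N))
    rw [← pow_add]
    congr 1
    omega
  have hprod : ∏ i : Fin N, ∏ j : Fin N, (1 - v i * q ^ (j : ℕ) / (s0 * ξ0 * γ))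
      = ∏ i : Fin N, ∏ j : Fin N, (1 - q ^ (i : ℕ) * u0 * v j) := by
    rw [Finset.prod_comm]
    refine Finset.prod_congr rfl fun i _ => Finset.prod_congr rfl fun j _ => ?_
    rw [hu0]
    ring
  rw [hvand] at hcauchy
  rw [hdet, hprod, ← hpow, div_mul_eq_mul_div, div_eq_iff (mul_ne_zero hVu hVv)]
  simp only [Finset.prod_mul_distrib] at hcauchy ⊢
  linear_combination (∏ i : Fin N, ∏ j : Fin N, (1 - q ^ (i : ℕ) * u0 * v j))
    * (∏ i : Fin N, q ^ ((i : ℕ) + 1)) * ((∏ i : Fin N, (1 - γ * q ^ (-((i : ℕ) : ℤ))))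
      * ∏ i : Fin N, (1 - s0 ^ 2 * γ * q ^ (-((i : ℕ) : ℤ) - 1))) * hcauchy
end
end

section
/- Residue summation identity used in the LU decomposition (equation (3.18) in the proof of Lemma 3.6). Let q, γ, s_0, ξ_0 ∈ ℂ with s_0ξ_0γ ≠ 0, set u_0 = 1/(s_0ξ_0γ), and let f_k(v) = ∏_{r=1}^{k}(q^r v − γs_0ξ_0). Fix integers i, j with 1 ≤ j ≤ i−1, and let v_1,…,v_i be pairwise distinct complex numbers such that q^{j−1}u_0v_k ≠ 1 and q^{j}u_0v_k ≠ 1 for all 1 ≤ k ≤ i. Then f_{i−1}(v_i)/∏_{r=1}^{i−1}(v_i−v_r) · z(q^{j−1}u_0, v_i) = − Σ_{k=1}^{i−1} [ f_{i−1}(v_k)/∏_{r=1, r≠k}^{i}(v_k−v_r) ] · z(q^{j−1}u_0, v_k). -/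
open scoped BigOperators

noncomputable section

/-- `f_k(v) = ∏_{r=1}^{k} (q^r v − γ s₀ ξ₀)`. -/
def ffun (q γ s0 ξ0 : ℂ) (k : ℕ) (v : ℂ) : ℂ :=
  ∏ r ∈ Finset.range k, (q ^ (r + 1) * v - γ * s0 * ξ0)

open Polynomial in
theorem natDegree_prod_linear_le (s : Finset ℕ) (q a : ℂ) :
    (∏ r ∈ s, (C (q ^ (r + 1)) * X - C a)).natDegree ≤ s.card := by
  refine (natDegree_prod_le _ _).trans ?_
  refine (Finset.sum_le_card_nsmul _ _ 1 fun r _ => ?_).trans (by simp)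
  rw [sub_eq_add_neg, ← C_neg]
  exact natDegree_linear_le

open Polynomial in
/-- The apparent poles of `z(q^{j-1} u₀, ·)` cancel against `f_n`, leaving a polynomial of degree
less than `n`. -/
theorem exists_polynomial_eval_eq_ffun_mul_zfun (q γ s0 ξ0 : ℂ) (h0 : s0 * ξ0 * γ ≠ 0)
    (n j : ℕ) (hj : 1 ≤ j) (hjn : j ≤ n) :
    ∃ P : ℂ[X], P.natDegree < n ∧ ∀ x : ℂ,
      q ^ (j - 1) * (1 / (s0 * ξ0 * γ)) * x ≠ 1 → q ^ j * (1 / (s0 * ξ0 * γ)) * x ≠ 1 →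
      P.eval x = ffun q γ s0 ξ0 n x * zfun q γ s0 ξ0 (q ^ (j - 1) * (1 / (s0 * ξ0 * γ))) x := by
  have hs : s0 ≠ 0 := by rintro rfl; simp at h0
  have hξ : ξ0 ≠ 0 := by rintro rfl; simp at h0
  have hγ : γ ≠ 0 := by rintro rfl; simp at h0
  obtain ⟨m, rfl⟩ : ∃ m, j = m + 1 := ⟨j - 1, by omega⟩
  have hm : m ∈ Finset.range n := by simpa using hjn
  have factor_eq (k : ℕ) (x : ℂ) : q ^ k * x - γ * s0 * ξ0
      = -(γ * s0 * ξ0) * (1 - q ^ k * (1 / (s0 * ξ0 * γ)) * x) := by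
    field_simp
    ring
  simp only [Nat.add_sub_cancel]
  rcases m with _ | m
  · refine ⟨C (-(γ * s0 * ξ0) * ((1 - γ) * (q - γ * s0 ^ 2))) *
      ∏ r ∈ (Finset.range n).erase 0, (C (q ^ (r + 1)) * X - C (γ * s0 * ξ0)), ?_, ?_⟩
    · have h1 := natDegree_prod_linear_le ((Finset.range n).erase 0) q (γ * s0 * ξ0)
      rw [Finset.card_erase_of_mem hm, Finset.card_range] at h1
      have := (natDegree_C_mul_le (-(γ * s0 * ξ0) * ((1 - γ) * (q - γ * s0 ^ 2)))
        (∏ r ∈ (Finset.range n).erase 0, (C (q ^ (r + 1)) * X - C (γ * s0 * ξ0)))).trans h1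
      omega
    · intro x hx1 hx2
      rw [ffun, ← Finset.mul_prod_erase _ _ hm, zfun]
      simp only [eval_mul, eval_prod, eval_C, eval_sub, eval_X]
      rw [factor_eq]
      have hu : 1 - γ * ξ0 * s0 * (q ^ 0 * (1 / (s0 * ξ0 * γ))) = 0 := by
        field_simp
        simp
      have hd1 := sub_ne_zero.2 hx1.symm
      have hd2 := sub_ne_zero.2 hx2.symm
      rw [hu, ← mul_assoc q, ← pow_succ']
      generalize 1 - q ^ 0 * (1 / (s0 * ξ0 * γ)) * x = A at *
      generalize 1 - q ^ (0 + 1) * (1 / (s0 * ξ0 * γ)) * x = B at *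
      rw [mul_div_assoc', eq_div_iff (mul_ne_zero hd1 hd2)]
      ring
  · have hm' : m ∈ (Finset.range n).erase (m + 1) := by
      simp only [Finset.mem_erase, Finset.mem_range] at hm ⊢
      omega
    set u := q ^ (m + 1) * (1 / (s0 * ξ0 * γ)) with hu
    set S := ((Finset.range n).erase (m + 1)).erase m with hS
    set L : ℂ[X] := C ((1 - γ) * (q - γ * s0 ^ 2)) * (C (-u) * X + C 1) +
      C ((1 - q) * (1 - γ * ξ0 * s0 * u)) * (C (-(γ * ξ0⁻¹ * s0)) * X + C 1) with hL
    refine ⟨C ((γ * s0 * ξ0) ^ 2) * L *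
      ∏ r ∈ S, (C (q ^ (r + 1)) * X - C (γ * s0 * ξ0)), ?_, ?_⟩
    · have h1 := natDegree_prod_linear_le S q (γ * s0 * ξ0)
      rw [hS, Finset.card_erase_of_mem hm', Finset.card_erase_of_mem hm, Finset.card_range,
        ← hS] at h1
      have h2 : L.natDegree ≤ 1 := natDegree_add_le_of_degree_le
        ((natDegree_C_mul_le _ _).trans natDegree_linear_le)
        ((natDegree_C_mul_le _ _).trans natDegree_linear_le)
      have h3 := natDegree_mul_le_of_le ((natDegree_C_mul_le ((γ * s0 * ξ0) ^ 2) L).trans h2) h1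
      omega
    · intro x hx1 hx2
      rw [ffun, ← Finset.mul_prod_erase _ _ hm, ← Finset.mul_prod_erase _ _ hm', zfun]
      simp only [hL, eval_mul, eval_prod, eval_C, eval_sub, eval_X, eval_add]
      rw [factor_eq, factor_eq]
      have hd1 := sub_ne_zero.2 hx1.symm
      have hd2 := sub_ne_zero.2 hx2.symm
      have hqu : q * u * x = q ^ (m + 1 + 1) * (1 / (s0 * ξ0 * γ)) * x := by
        rw [hu]; ring
      rw [hqu, ← hu]
      generalize 1 - q ^ (m + 1 + 1) * (1 / (s0 * ξ0 * γ)) * x = B at *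
      rw [show -u * x + 1 = 1 - u * x by ring]
      generalize 1 - u * x = A at *
      rw [mul_div_assoc', eq_div_iff (mul_ne_zero hd1 hd2)]
      ring

/-- Residue summation identity used in the LU decomposition
(equation (3.18) in the proof of Lemma 3.6). -/
theorem residue_summation_identity
    (q γ s0 ξ0 : ℂ) (h0 : s0 * ξ0 * γ ≠ 0)
    (i j : ℕ) (hj : 1 ≤ j) (hij : j + 1 ≤ i)
    (v : Fin i → ℂ) (hv : Function.Injective v)
    (h1 : ∀ k : Fin i, q ^ (j - 1) * (1 / (s0 * ξ0 * γ)) * v k ≠ 1)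
    (h2 : ∀ k : Fin i, q ^ j * (1 / (s0 * ξ0 * γ)) * v k ≠ 1) :
    ffun q γ s0 ξ0 (i - 1) (v ⟨i - 1, by omega⟩)
        / (∏ r ∈ Finset.univ.filter (fun r : Fin i => r ≠ ⟨i - 1, by omega⟩),
            (v ⟨i - 1, by omega⟩ - v r))
        * zfun q γ s0 ξ0 (q ^ (j - 1) * (1 / (s0 * ξ0 * γ))) (v ⟨i - 1, by omega⟩)
    = - ∑ k ∈ Finset.univ.filter (fun k : Fin i => k ≠ ⟨i - 1, by omega⟩),
          (ffun q γ s0 ξ0 (i - 1) (v k) / ∏ r ∈ Finset.univ.erase k, (v k - v r))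
            * zfun q γ s0 ξ0 (q ^ (j - 1) * (1 / (s0 * ξ0 * γ))) (v k) := by
  obtain ⟨P, hdeg, hP⟩ := exists_polynomial_eval_eq_ffun_mul_zfun q γ s0 ξ0 h0 (i - 1) j hj
    (by omega)
  have hcard : (Finset.univ : Finset (Fin i)).card = i := by simp
  have hlt : P.degree < (Finset.univ : Finset (Fin i)).card := by
    rw [hcard]
    exact Polynomial.degree_le_natDegree.trans_lt (by exact_mod_cast (by omega))
  have hsum := Lagrange.coeff_eq_sum (s := Finset.univ) hv.injOn hlt
  rw [hcard, Polynomial.coeff_eq_zero_of_natDegree_lt hdeg,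
    ← Finset.add_sum_erase _ _ (Finset.mem_univ (⟨i - 1, by omega⟩ : Fin i))] at hsum
  simp only [hP _ (h1 _) (h2 _), mul_div_right_comm] at hsum
  simp only [Finset.filter_ne']
  exact eq_neg_of_add_eq_zero_left hsum.symm
end
end

section
/- Determinantal identity at the interpolation Hall–Littlewood specialization (Proposition 5.1). Let N ≥ 1, let t ∈ ℂ∖{0} and χ ∈ ℂ, let u_1,…,u_N be pairwise distinct nonzero complex numbers and v_1,…,v_N be pairwise distinct complex numbers with u_iv_j ≠ 1 and tu_iv_j ≠ 1 for all i,j. Then [1/∏_{1≤i<j≤N}(u_i−u_j)] · det_{1≤i,j≤N}[ u_j^{N−i−1} ( (u_j−t^{1−N}) ∏_{l=1}^N (1−tu_jv_l)/(1−u_jv_l) + t^{1−i}(1−χu_j) ) ] = [∏_{i,j=1}^N(1−tu_iv_j) / ∏_{1≤i<j≤N}(u_i−u_j)(v_i−v_j)] · det_{1≤i,j≤N}[ ((1−t^{−N}χ)t(1−u_iv_j) + (1−t)(1−t^{1−N}v_j)) / ((1−u_iv_j)(1−tu_iv_j)) ]. -/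
open scoped BigOperators

noncomputable section

open Finset in
/-- Divided difference of `y ^ i / (1 - z * y)` at distinct nodes. -/
theorem sum_nodalWeight_mul_pow_div {N : ℕ} {v : Fin N → ℂ} (hv : Function.Injective v)
    {z : ℂ} (hz : z ≠ 0) (hzv : ∀ j, z * v j ≠ 1) (i : Fin N) :
    ∑ j, Lagrange.nodalWeight univ v j * v j ^ (i : ℕ) / (1 - z * v j)
      = z ^ ((N : ℤ) - (i : ℕ) - 1) / ∏ l, (1 - z * v l) := by
  have hne : ∀ j, 1 - z * v j ≠ 0 := fun j h => hzv j (sub_eq_zero.mp h).symm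
  have hnode : ∀ j, z⁻¹ - v j = z⁻¹ * (1 - z * v j) := fun j => by field_simp
  have hinterp := Lagrange.eval_interpolate_not_at_node (s := univ) (v := v) (x := z⁻¹)
    (fun j => v j ^ (i : ℕ))
    (fun j _ h => hzv j (by rw [← h, mul_inv_cancel₀ hz]))
  have hX : (Polynomial.X ^ (i : ℕ) : Polynomial ℂ)
      = Lagrange.interpolate univ v fun j => v j ^ (i : ℕ) := by
    refine Lagrange.eq_interpolate_of_eval_eq _ hv.injOn ?_ fun j _ => by simp
    rw [Polynomial.degree_X_pow]
    simp
  rw [← hX, Polynomial.eval_pow, Polynomial.eval_X, Lagrange.eval_nodal,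
    prod_congr rfl fun j _ => hnode j, prod_mul_distrib, prod_const, card_univ,
    Fintype.card_fin] at hinterp
  have hsum : ∑ j, Lagrange.nodalWeight univ v j * (z⁻¹ - v j)⁻¹ * v j ^ (i : ℕ)
      = z * ∑ j, Lagrange.nodalWeight univ v j * v j ^ (i : ℕ) / (1 - z * v j) := by
    rw [mul_sum]
    refine sum_congr rfl fun j _ => ?_
    rw [hnode j, mul_inv, inv_inv]
    ring
  rw [hsum] at hinterp
  have hprod : ∏ l, (1 - z * v l) ≠ 0 := prod_ne_zero_iff.mpr fun j _ => hne j
  rw [eq_div_iff hprod, zpow_sub₀ hz, zpow_sub₀ hz, zpow_natCast, zpow_natCast, zpow_one]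
  simp only [inv_pow] at hinterp
  field_simp at hinterp ⊢
  linear_combination -hinterp

open Finset in
theorem prod_nodalWeight {N : ℕ} (v : Fin N → ℂ) :
    ∏ j, Lagrange.nodalWeight univ v j
      = (vandP v * (Matrix.vandermonde v).det)⁻¹ := by
  simp only [Lagrange.nodalWeight, prod_inv_distrib]
  have hswap : ∏ i, ∏ j ∈ Ioi i, (v j - v i) = ∏ j, ∏ i ∈ Iio j, (v j - v i) :=
    prod_comm' (by simp)
  rw [inv_inj, Matrix.det_vandermonde, vandP_eq_prod_Ioi, hswap, ← prod_mul_distrib]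
  refine prod_congr rfl fun j _ => ?_
  rw [← prod_union (disjoint_left.mpr fun l h h' => by
    simp only [mem_Ioi, mem_Iio] at h h'; exact lt_asymm h h')]
  congr 1
  ext l
  simp only [mem_erase, mem_univ, and_true, mem_union, mem_Ioi, mem_Iio]
  exact ⟨fun h => (lt_or_gt_of_ne h).symm, fun h => h.elim ne_of_gt ne_of_lt⟩

open Finset in
theorem det_nodalWeight_mul_pow {N : ℕ} {v : Fin N → ℂ} (hv : Function.Injective v) :
    (Matrix.of fun i j : Fin N => Lagrange.nodalWeight univ v j * v j ^ (i : ℕ)).det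
      = (vandP v)⁻¹ := by
  have h := Matrix.det_mul_row (Lagrange.nodalWeight univ v) (Matrix.vandermonde v).transpose
  simp only [Matrix.transpose_apply, Matrix.vandermonde_apply] at h
  rw [h, prod_nodalWeight, Matrix.det_transpose, mul_inv, mul_assoc,
    inv_mul_cancel₀ (Matrix.det_vandermonde_ne_zero_iff.mpr hv), mul_one]

open Finset in
/-- Expansion of the entries of the left-hand matrix in the functions of the right-hand one, with
coefficients depending only on `v`. -/
theorem sum_nodalWeight_mul_entry {N : ℕ} {t : ℂ} (ht : t ≠ 0) (χ : ℂ) {v : Fin N → ℂ}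
    (hv : Function.Injective v) {x : ℂ} (hx : x ≠ 0) (hxv : ∀ j, x * v j ≠ 1)
    (htxv : ∀ j, t * x * v j ≠ 1) (i : Fin N) :
    ∑ j, Lagrange.nodalWeight univ v j * v j ^ (i : ℕ)
        * ((∏ l, (1 - t * x * v l))
          * (((1 - t ^ (-(N : ℤ)) * χ) * t * (1 - x * v j)
              + (1 - t) * (1 - t ^ (1 - (N : ℤ)) * v j))
            / ((1 - x * v j) * (1 - t * x * v j))))
      = x ^ ((N : ℤ) - (i : ℕ) - 2)
        * ((x - t ^ (1 - (N : ℤ))) * ∏ l, (1 - t * x * v l) / (1 - x * v l)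
          + t ^ (-((i : ℕ) : ℤ)) * (1 - χ * x)) := by
  have hne : ∀ j, 1 - x * v j ≠ 0 := fun j h => hxv j (sub_eq_zero.mp h).symm
  have htne : ∀ j, 1 - t * x * v j ≠ 0 := fun j h => htxv j (sub_eq_zero.mp h).symm
  have hP : ∏ l, (1 - t * x * v l) ≠ 0 := prod_ne_zero_iff.mpr fun j _ => htne j
  have hQ : ∏ l, (1 - x * v l) ≠ 0 := prod_ne_zero_iff.mpr fun j _ => hne j
  have hb : t ^ (1 - (N : ℤ)) = t ^ (-(N : ℤ)) * t := by
    rw [← zpow_add_one₀ ht]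
    congr 1
    ring
  have hti : t ^ (1 - (N : ℤ)) * t ^ ((N : ℤ) - (i : ℕ) - 1) = t ^ (-((i : ℕ) : ℤ)) := by
    rw [← zpow_add₀ ht]
    congr 1
    ring
  have hxi : x ^ ((N : ℤ) - (i : ℕ) - 1) = x ^ ((N : ℤ) - (i : ℕ) - 2) * x := by
    rw [← zpow_add_one₀ hx]
    congr 1
    ring
  have hsplit : ∀ j, Lagrange.nodalWeight univ v j * v j ^ (i : ℕ)
        * ((∏ l, (1 - t * x * v l))
          * (((1 - t ^ (-(N : ℤ)) * χ) * t * (1 - x * v j)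
              + (1 - t) * (1 - t ^ (1 - (N : ℤ)) * v j))
            / ((1 - x * v j) * (1 - t * x * v j))))
      = (∏ l, (1 - t * x * v l)) * (1 - t ^ (1 - (N : ℤ)) / x)
          * (Lagrange.nodalWeight univ v j * v j ^ (i : ℕ) / (1 - x * v j))
        + (∏ l, (1 - t * x * v l)) * (t ^ (1 - (N : ℤ)) * (1 - χ * x) / x)
          * (Lagrange.nodalWeight univ v j * v j ^ (i : ℕ) / (1 - t * x * v j)) := by
    intro j
    have h1 := hne j
    have h2 := htne j
    rw [hb]
    generalize t ^ (-(N : ℤ)) = c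
    generalize ∏ l, (1 - t * x * v l) = P
    generalize Lagrange.nodalWeight univ v j * v j ^ (i : ℕ) = w
    field_simp
    ring
  rw [sum_congr rfl fun j _ => hsplit j, sum_add_distrib, ← mul_sum, ← mul_sum,
    sum_nodalWeight_mul_pow_div hv hx hxv i,
    sum_nodalWeight_mul_pow_div hv (mul_ne_zero ht hx) htxv i, mul_zpow, prod_div_distrib,
    ← hti, hxi]
  generalize t ^ (1 - (N : ℤ)) = b
  generalize t ^ ((N : ℤ) - (i : ℕ) - 1) = c
  generalize x ^ ((N : ℤ) - (i : ℕ) - 2) = d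
  generalize ∏ l, (1 - t * x * v l) = P at *
  generalize ∏ l, (1 - x * v l) = Q at *
  field_simp

/-- Determinantal identity at the interpolation Hall–Littlewood specialization
(Proposition 5.1). -/
theorem det_identity_interpolation_HL
    (N : ℕ) (hN : 1 ≤ N) (t : ℂ) (ht : t ≠ 0) (χ : ℂ)
    (u v : Fin N → ℂ) (hu : Function.Injective u) (hu0 : ∀ i, u i ≠ 0)
    (hv : Function.Injective v)
    (huv : ∀ i j : Fin N, u i * v j ≠ 1) (htuv : ∀ i j : Fin N, t * u i * v j ≠ 1) :
    (1 / vandP u)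
      * Matrix.det (Matrix.of fun i j : Fin N =>
          u j ^ ((N : ℤ) - (i : ℕ) - 2)
            * ((u j - t ^ (1 - (N : ℤ)))
                  * ∏ l : Fin N, (1 - t * u j * v l) / (1 - u j * v l)
                + t ^ (-((i : ℕ) : ℤ)) * (1 - χ * u j)))
    = ((∏ i : Fin N, ∏ j : Fin N, (1 - t * u i * v j)) / (vandP u * vandP v))
        * Matrix.det (Matrix.of fun i j : Fin N =>
            ((1 - t ^ (-(N : ℤ)) * χ) * t * (1 - u i * v j)
                + (1 - t) * (1 - t ^ (1 - (N : ℤ)) * v j))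
              / ((1 - u i * v j) * (1 - t * u i * v j))) := by
  have hfactor : (Matrix.of fun i j : Fin N =>
          u j ^ ((N : ℤ) - (i : ℕ) - 2)
            * ((u j - t ^ (1 - (N : ℤ)))
                  * ∏ l : Fin N, (1 - t * u j * v l) / (1 - u j * v l)
                + t ^ (-((i : ℕ) : ℤ)) * (1 - χ * u j)))
      = (Matrix.of fun i j : Fin N =>
          Lagrange.nodalWeight Finset.univ v j * v j ^ (i : ℕ))
        * (Matrix.of fun i j : Fin N => (∏ l, (1 - t * u i * v l))
          * (Matrix.of fun i j : Fin N =>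
            ((1 - t ^ (-(N : ℤ)) * χ) * t * (1 - u i * v j)
                + (1 - t) * (1 - t ^ (1 - (N : ℤ)) * v j))
              / ((1 - u i * v j) * (1 - t * u i * v j))) i j).transpose := by
    ext i j
    exact (sum_nodalWeight_mul_entry ht χ hv (hu0 j) (huv j) (htuv j) i).symm
  rw [hfactor, Matrix.det_mul, Matrix.det_transpose, det_nodalWeight_mul_pow hv,
    Matrix.det_mul_column]
  generalize Matrix.det (n := Fin N) (R := ℂ) _ = d
  rw [div_eq_mul_inv, div_eq_mul_inv, mul_inv]
  ring
end
end

section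
/- Schur expansion of the Izergin–Korepin type determinant (Theorem 6.1). Let N ≥ 1, q ∈ (0,1), γ ∈ ℂ, s_0 ∈ ℂ, ξ_0 ∈ ℂ∖{0}. Let u_1,…,u_N be pairwise distinct and v_1,…,v_N be pairwise distinct complex numbers with |u_iv_j| < 1 for all 1 ≤ i,j ≤ N. Then the family indexed by λ ∈ Sign_N with terms C_λ(u_1,…,u_N)·s_λ(v_1,…,v_N) is absolutely summable, and det[z(u_i,v_j)]_{i,j=1}^N / ∏_{1≤i<j≤N}(u_i−u_j)(v_i−v_j) = Σ_{λ∈Sign_N} C_λ(u_1,…,u_N) · s_λ(v_1,…,v_N). -/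
open scoped BigOperators

noncomputable section

/-- A (nonnegative) signature of length `N`: a weakly decreasing `N`-tuple of
nonnegative integers. -/
def Sign (N : ℕ) : Type :=
  {lam : Fin N → ℕ // ∀ i j : Fin N, i ≤ j → lam j ≤ lam i}

/-- `c_k(u) = u^k(1−γq^{k+1}+s₀²γ(γ−q^k)) − s₀γ((1−q^k)u^{k−1}/ξ₀ + (1−q^{k+1})u^{k+1}ξ₀)`
(the `u^{k−1}` term vanishes at `k = 0` since `1 − q^0 = 0`). -/
def cfun (q γ s0 ξ0 : ℂ) (k : ℕ) (u : ℂ) : ℂ :=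
  u ^ k * (1 - γ * q ^ (k + 1) + s0 ^ 2 * γ * (γ - q ^ k))
    - s0 * γ * ((1 - q ^ k) * u ^ (k - 1) / ξ0 + (1 - q ^ (k + 1)) * u ^ (k + 1) * ξ0)

/-- The deformed Schur polynomial
`C_λ(u) = det[c_{λ_i+N−i}(u_j)] / ∏_{i<j}(u_i−u_j)`. -/
def Cfun (q γ s0 ξ0 : ℂ) {N : ℕ} (lam : Fin N → ℕ) (u : Fin N → ℂ) : ℂ :=
  Matrix.det (Matrix.of fun i j : Fin N =>
    cfun q γ s0 ξ0 (lam i + (N - 1 - (i : ℕ))) (u j)) / vandP u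

/-- The Schur polynomial `s_λ(v) = det[v_i^{λ_j+N−j}] / ∏_{i<j}(v_i−v_j)`. -/
def schur {N : ℕ} (lam : Fin N → ℕ) (v : Fin N → ℂ) : ℂ :=
  Matrix.det (Matrix.of fun i j : Fin N =>
    v i ^ (lam j + (N - 1 - (j : ℕ)))) / vandP v

theorem hasSum_prod_apply {n : ℕ} (a : Fin n → ℕ → ℂ) (s : Fin n → ℂ)
    (h : ∀ i, HasSum (a i) (s i)) :
    HasSum (fun f : Fin n → ℕ => ∏ i, a i (f i)) (∏ i, s i) := by
  induction n with
  | zero => simpa only [Finset.univ_eq_empty, Finset.prod_empty] using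
      hasSum_unique (fun f : Fin 0 → ℕ => ∏ i, a i (f i))
  | succ n ih =>
    have hhead := h 0
    have htail := ih (fun i => a i.succ) (fun i => s i.succ) (fun i => h i.succ)
    have hsummable := summable_mul_of_summable_norm hhead.summable.norm htail.summable.norm
    have hprod := hhead.mul htail hsummable
    rw [Fin.prod_univ_succ, ← (Fin.consEquiv (fun _ : Fin (n + 1) => ℕ)).hasSum_iff]
    refine hprod.congr_fun fun p => ?_
    simp [Fin.prod_univ_succ]

/-- The generating function `z(u,v) = ∑ₖ cₖ(u) vᵏ`. -/
theorem hasSum_cfun_mul_pow {q : ℝ} (hq0 : 0 < q) (hq1 : q < 1) (γ s0 : ℂ) {ξ0 : ℂ}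
    (hξ : ξ0 ≠ 0) {u v : ℂ} (huv : ‖u * v‖ < 1) :
    HasSum (fun k => cfun q γ s0 ξ0 k u * v ^ k) (zfun q γ s0 ξ0 u v) := by
  have hquv : ‖(q : ℂ) * (u * v)‖ < 1 := by
    rw [norm_mul, Complex.norm_real, Real.norm_of_nonneg hq0.le]
    nlinarith [norm_nonneg (u * v)]
  have ne_of_norm : ∀ x : ℂ, ‖x‖ < 1 → 1 - x ≠ 0 := by
    intro x hx h0
    rw [← sub_eq_zero.mp h0] at hx
    simp at hx
  have hne := ne_of_norm _ huv
  have hqne := ne_of_norm _ hquv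
  have h1 := hasSum_geometric_of_norm_lt_one huv
  have h2 := hasSum_geometric_of_norm_lt_one hquv
  have hdiff := h1.sub (h2.mul_left (q : ℂ))
  have hshift : HasSum (fun k : ℕ => (1 - (q : ℂ) ^ k) * u ^ (k - 1) * v ^ k)
      (v * ((1 - u * v)⁻¹ - q * (1 - q * (u * v))⁻¹)) := by
    rw [← hasSum_nat_add_iff' 1]
    simp only [Finset.sum_range_one, pow_zero, sub_self, zero_mul, sub_zero]
    refine (hdiff.mul_left v).congr_fun ?_
    intro k
    simp only [Nat.add_sub_cancel]
    ring
  have htotal := (((h1.mul_left (1 + s0 ^ 2 * γ ^ 2)).sub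
    (h2.mul_left (γ * q + s0 ^ 2 * γ))).sub (hshift.mul_left (s0 * γ / ξ0))).sub
    (hdiff.mul_left (s0 * γ * ξ0 * u))
  have hvalue : zfun q γ s0 ξ0 u v =
      (1 + s0 ^ 2 * γ ^ 2) * (1 - u * v)⁻¹ -
      (γ * q + s0 ^ 2 * γ) * (1 - q * (u * v))⁻¹ -
      s0 * γ / ξ0 * (v * ((1 - u * v)⁻¹ - q * (1 - q * (u * v))⁻¹)) -
      s0 * γ * ξ0 * u * ((1 - u * v)⁻¹ - q * (1 - q * (u * v))⁻¹) := by
    have hqne' : 1 - (q : ℂ) * u * v ≠ 0 := by rwa [mul_assoc]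
    rw [zfun, ← mul_assoc (q : ℂ) u v]
    field_simp
    ring
  rw [hvalue]
  refine htotal.congr_fun fun k => ?_
  simp only [cfun]
  ring

theorem StrictAnti.apply_add_sub_le {n : ℕ} {g : Fin n → ℕ} (hg : StrictAnti g)
    {i j : Fin n} (hij : i ≤ j) : g j + ((j : ℕ) - i) ≤ g i := by
  obtain ⟨i, hi⟩ := i
  obtain ⟨j, hj⟩ := j
  obtain ⟨d, rfl⟩ := Nat.exists_eq_add_of_le (Fin.mk_le_mk.mp hij)
  clear hij
  induction d with
  | zero => simp
  | succ d ih =>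
    have h1 := ih (by omega)
    have h2 : g ⟨i + (d + 1), hj⟩ < g ⟨i + d, by omega⟩ := hg (Fin.mk_lt_mk.mpr (by omega))
    simp only at h1 ⊢
    omega

/-- The shifted parts `λᵢ + N - i` of a signature. -/
def Sign.shifted {N : ℕ} (lam : Sign N) (i : Fin N) : ℕ := lam.1 i + (N - 1 - (i : ℕ))

theorem Sign.shifted_strictAnti {N : ℕ} (lam : Sign N) : StrictAnti lam.shifted := by
  intro i j hij
  have h := lam.2 i j hij.le
  have hij' : (i : ℕ) < j := hij
  simp only [Sign.shifted]
  omega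

theorem Sign.shifted_injective {N : ℕ} : Function.Injective (Sign.shifted (N := N)) := by
  intro lam mu h
  refine Subtype.ext (funext fun i => ?_)
  have hi := congrFun h i
  simp only [Sign.shifted] at hi
  omega

theorem Sign.exists_shifted_eq {N : ℕ} {g : Fin N → ℕ} (hg : StrictAnti g) :
    ∃ lam : Sign N, lam.shifted = g := by
  have hle : ∀ i : Fin N, N - 1 - (i : ℕ) ≤ g i := by
    intro i
    have hlast : i ≤ ⟨N - 1, Nat.sub_one_lt_of_lt i.2⟩ :=
      Fin.le_def.mpr (Nat.le_sub_one_of_lt i.2)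
    have h := hg.apply_add_sub_le hlast
    simp only at h
    omega
  refine ⟨⟨fun i => g i - (N - 1 - (i : ℕ)), fun i j hij => ?_⟩, funext fun i => ?_⟩
  · have h := hg.apply_add_sub_le hij
    have hij' : (i : ℕ) ≤ j := hij
    have hi := hle i
    have hj := hle j
    simp only
    omega
  · exact Nat.sub_add_cancel (hle i)

/-- A signature together with an ordering of its shifted parts. -/
def Sign.arrange {N : ℕ} (p : Sign N × Equiv.Perm (Fin N)) : Fin N → ℕ :=
  p.1.shifted ∘ p.2

theorem Sign.arrange_injective {N : ℕ} : Function.Injective (Sign.arrange (N := N)) := by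
  rintro ⟨lam, τ⟩ ⟨mu, ρ⟩ h
  simp only [Sign.arrange] at h
  have hrange : Set.range lam.shifted = Set.range mu.shifted := by
    rw [← τ.surjective.range_comp lam.shifted, h, ρ.surjective.range_comp]
  obtain rfl : lam = mu := Sign.shifted_injective <|
    (lam.shifted_strictAnti.range_inj mu.shifted_strictAnti).mp hrange
  refine Prod.ext rfl (Equiv.ext fun i => ?_)
  exact lam.shifted_strictAnti.injective (congrFun h i)

theorem Sign.mem_range_arrange {N : ℕ} {f : Fin N → ℕ} (hf : Function.Injective f) :
    f ∈ Set.range (Sign.arrange (N := N)) := by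
  let σ : Equiv.Perm (Fin N) := Fin.revPerm.trans (Tuple.sort f)
  have hsort : StrictMono (f ∘ Tuple.sort f) :=
    (Tuple.monotone_sort f).strictMono_of_injective (hf.comp (Tuple.sort f).injective)
  have hanti : StrictAnti (f ∘ σ) := hsort.comp_strictAnti Fin.rev_strictAnti
  obtain ⟨lam, hlam⟩ := Sign.exists_shifted_eq hanti
  refine ⟨(lam, σ⁻¹), ?_⟩
  funext i
  simp [Sign.arrange, hlam]

/-- The Cauchy–Binet formula for products of `N × ℕ` and `ℕ × N` matrices. -/
theorem hasSum_det_mul_det {N : ℕ} (A : Fin N → ℕ → ℂ) (B : ℕ → Fin N → ℂ)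
    (Z : Matrix (Fin N) (Fin N) ℂ) (h : ∀ i j, HasSum (fun k => A i k * B k j) (Z i j)) :
    HasSum (fun lam : Sign N =>
      Matrix.det (Matrix.of fun i j => A j (lam.shifted i)) *
        Matrix.det (Matrix.of fun i j => B (lam.shifted j) i)) Z.det := by
  have hrows : HasSum (fun f : Fin N → ℕ =>
      (∏ i, A i (f i)) * Matrix.det (Matrix.of fun i j => B (f j) i)) Z.det := by
    have hsum := hasSum_sum (s := Finset.univ) fun (σ : Equiv.Perm (Fin N)) _ =>
      (hasSum_prod_apply _ _ fun i => h i (σ i)).mul_left ((Equiv.Perm.sign σ : ℤ) : ℂ)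
    rw [← Matrix.det_transpose Z, Matrix.det_apply']
    refine hsum.congr_fun fun f => ?_
    rw [Matrix.det_apply', Finset.mul_sum]
    refine Finset.sum_congr rfl fun σ _ => ?_
    simp only [Matrix.of_apply, Finset.prod_mul_distrib]
    ring
  rw [← Sign.arrange_injective.hasSum_iff] at hrows
  · refine (hrows.prod_fiberwise fun lam => hasSum_fintype _).congr_fun fun lam => ?_
    rw [Matrix.det_apply', Finset.sum_mul]
    refine Finset.sum_congr rfl fun τ _ => ?_
    have hperm := Matrix.det_permute' τ (Matrix.of fun i j => B (lam.shifted j) i)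
    simp only [Function.comp_apply, Sign.arrange, Matrix.of_apply]
    erw [hperm]
    ring
  · intro f hf
    have hninj : ¬ Function.Injective f := fun hinj => hf (Sign.mem_range_arrange hinj)
    simp only [Function.Injective, not_forall] at hninj
    obtain ⟨i, j, hij, hne⟩ := hninj
    rw [Matrix.det_zero_of_column_eq hne (fun k => by simp [hij]), mul_zero]

/-- Schur expansion of the Izergin–Korepin type determinant (Theorem 6.1). -/
theorem schur_expansion_IK_det
    (N : ℕ) (hN : 1 ≤ N)
    (q : ℝ) (hq0 : 0 < q) (hq1 : q < 1)
    (γ s0 ξ0 : ℂ) (hξ : ξ0 ≠ 0)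
    (u v : Fin N → ℂ) (hu : Function.Injective u) (hv : Function.Injective v)
    (huv : ∀ i j : Fin N, ‖u i * v j‖ < 1) :
    Summable (fun lam : Sign N =>
      ‖Cfun (q : ℂ) γ s0 ξ0 lam.1 u * schur lam.1 v‖)
    ∧ Matrix.det (Matrix.of fun i j : Fin N => zfun (q : ℂ) γ s0 ξ0 (u i) (v j))
        / (vandP u * vandP v)
      = ∑' lam : Sign N, Cfun (q : ℂ) γ s0 ξ0 lam.1 u * schur lam.1 v := by
  have hdet := hasSum_det_mul_det (fun i k => cfun q γ s0 ξ0 k (u i)) (fun k j => v j ^ k)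
    (Matrix.of fun i j => zfun q γ s0 ξ0 (u i) (v j))
    fun i j => hasSum_cfun_mul_pow hq0 hq1 γ s0 hξ (huv i j)
  have hsum : HasSum (fun lam : Sign N => Cfun (q : ℂ) γ s0 ξ0 lam.1 u * schur lam.1 v)
      (Matrix.det (Matrix.of fun i j : Fin N => zfun (q : ℂ) γ s0 ξ0 (u i) (v j))
        / (vandP u * vandP v)) := by
    refine (hdet.div_const (vandP u * vandP v)).congr_fun fun lam => ?_
    exact div_mul_div_comm _ _ _ _
  exact ⟨hsum.summable.norm, hsum.tsum_eq.symm⟩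
end
end

section
/- Summation identity for ASEP eigenfunctions (Corollary 7.1). Let N ≥ 1 and q ∈ (0,1). Let z_1,…,z_N be pairwise distinct and w_1,…,w_N be pairwise distinct complex numbers, with z_i, w_j ∉ {1, q}, z_i ≠ w_j and z_i ≠ qw_j for all i,j, and suppose |(1−w_j)(1−z_i/q)| < |(1−z_i)(1−w_j/q)| for all 1 ≤ i,j ≤ N. Then the family of products Ψ^r_x(z_1,…,z_N)·Ψ^ℓ_x(w_1,…,w_N), indexed by integer vectors x with 0 ≤ x_1 < x_2 < … < x_N, is absolutely summable, and Σ_{0≤x_1<…<x_N} Ψ^r_x(z) Ψ^ℓ_x(w) = ∏_{j=1}^N (1−z_j)(1−w_j/q) · (1/q−1)^{−N} · [∏_{i,j=1}^N (z_i−qw_j) / ∏_{1≤i<j≤N}(z_i−z_j)(w_j−w_i)] · det_{1≤i,j≤N}[ 1/((z_i−w_j)(z_i−qw_j)) ] = (1−q)^{−2N} / ∏_{1≤i<j≤N}(z_j−z_i) · det_{1≤i,j≤N}[ z_j^{i} ( (1−1/z_j)(1−q/z_j) ∏_{l=1}^N (z_j−qw_l)/(z_j−w_l) − q^{N−i}(1−1/z_j)(1−q²/z_j)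 ) ] (for the second form additionally assume z_j ≠ 0 for all j). -/
open scoped BigOperators

noncomputable section

/-- The right ASEP Bethe ansatz eigenfunction `Ψ^r_x(z_1,…,z_N)`. -/
def PsiR (q : ℂ) {N : ℕ} (x : Fin N → ℤ) (z : Fin N → ℂ) : ℂ :=
  ∑ σ : Equiv.Perm (Fin N),
    (∏ p ∈ Finset.univ.filter (fun p : Fin N × Fin N => p.1 < p.2),
      (z (σ p.1) - q * z (σ p.2)) / (z (σ p.1) - z (σ p.2)))
    * ∏ i : Fin N, ((1 - z (σ i)) / (1 - z (σ i) / q)) ^ (-(x i))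

/-- The left ASEP Bethe ansatz eigenfunction `Ψ^ℓ_x(z_1,…,z_N)`. -/
def PsiL (q : ℂ) {N : ℕ} (x : Fin N → ℤ) (z : Fin N → ℂ) : ℂ :=
  ∑ σ : Equiv.Perm (Fin N),
    (∏ p ∈ Finset.univ.filter (fun p : Fin N × Fin N => p.1 < p.2),
      (q * z (σ p.1) - z (σ p.2)) / (z (σ p.1) - z (σ p.2)))
    * ∏ i : Fin N, ((1 - z (σ i)) / (1 - z (σ i) / q)) ^ (x i)

open Finset Polynomial in
theorem lagrange_partial_fractions {ι : Type*} [Fintype ι] [DecidableEq ι] {v : ι → ℂ}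
    (hv : Function.Injective v) (P : ℂ[X]) (hP : P.degree < (Fintype.card ι : ℕ)) {x : ℂ}
    (hx : ∀ i, x ≠ v i) :
    ∑ j, P.eval (v j) / (∏ l ∈ univ.erase j, (v j - v l)) / (x - v j)
      = P.eval x / ∏ l, (x - v l) := by
  have h1 := Lagrange.eq_interpolate (s := univ) (v := v) (f := P) hv.injOn (by simpa using hP)
  have h2 := Lagrange.eval_interpolate_not_at_node (s := univ) (v := v)
    (fun i => P.eval (v i)) (x := x) (fun i _ => hx i)
  rw [← h1, Lagrange.eval_nodal] at h2
  have hne : ∏ l, (x - v l) ≠ 0 := prod_ne_zero_iff.2 fun l _ => sub_ne_zero.2 (hx l)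
  rw [h2, mul_div_cancel_left₀ _ hne]
  refine sum_congr rfl fun j _ => ?_
  rw [Lagrange.nodalWeight, prod_inv_distrib]
  ring

open Finset Polynomial in
/-- Taking a difference allows one degree more than Lagrange interpolation. -/
theorem lagrange_partial_fractions_sub {ι : Type*} [Fintype ι] [DecidableEq ι] {v : ι → ℂ}
    (hv : Function.Injective v) (P : ℂ[X]) (hP : P.degree ≤ (Fintype.card ι : ℕ)) {x y : ℂ}
    (hx : ∀ i, x ≠ v i) (hy : ∀ i, y ≠ v i) :
    ∑ j, P.eval (v j) / (∏ l ∈ univ.erase j, (v j - v l)) * (1 / (x - v j) - 1 / (y - v j))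
      = P.eval x / ∏ l, (x - v l) - P.eval y / ∏ l, (y - v l) := by
  set D := Lagrange.nodal univ v with hD
  have hmon : D.Monic := Lagrange.nodal_monic
  have hdeg : D.degree = (Fintype.card ι : ℕ) := by rw [hD, Lagrange.degree_nodal]; simp
  have hquot : (P /ₘ D).degree ≤ 0 := by
    by_cases h : P.degree < D.degree
    · rw [(divByMonic_eq_zero_iff hmon).2 h]; simp
    · have h1 := degree_add_divByMonic hmon (not_lt.1 h)
      rw [hdeg] at h1
      rw [← h1] at hP
      by_contra hcon
      push Not at hcon
      have hne : P /ₘ D ≠ 0 := by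
        intro h0
        simp [h0] at hcon
      rw [degree_eq_natDegree hne] at hP hcon
      norm_cast at hP hcon
      omega
  obtain ⟨c, hc⟩ : ∃ c, P /ₘ D = C c := ⟨_, eq_C_of_degree_le_zero hquot⟩
  have hdecomp : ∀ t, P.eval t = (P %ₘ D).eval t + c * ∏ l, (t - v l) := by
    intro t
    conv_lhs => rw [← modByMonic_add_div P D, hc]
    simp [hD, Lagrange.eval_nodal, mul_comm]
  have hnode : ∀ j, P.eval (v j) = (P %ₘ D).eval (v j) := by
    intro j
    rw [hdecomp, prod_eq_zero (mem_univ j) (sub_self _)]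
    ring
  have hlt : (P %ₘ D).degree < (Fintype.card ι : ℕ) := hdeg ▸ degree_modByMonic_lt P hmon
  have hxne : ∏ l, (x - v l) ≠ 0 := prod_ne_zero_iff.2 fun l _ => sub_ne_zero.2 (hx l)
  have hyne : ∏ l, (y - v l) ≠ 0 := prod_ne_zero_iff.2 fun l _ => sub_ne_zero.2 (hy l)
  rw [hdecomp x, hdecomp y, add_div, add_div, mul_div_cancel_right₀ _ hxne,
    mul_div_cancel_right₀ _ hyne, ← lagrange_partial_fractions hv _ hlt hx,
    ← lagrange_partial_fractions hv _ hlt hy, add_sub_add_right_eq_sub, ← sum_sub_distrib]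
  refine sum_congr rfl fun j _ => ?_
  rw [hnode]
  ring

open Finset Polynomial in
theorem sum_dilation_residues {ι : Type*} [Fintype ι] [DecidableEq ι] {v : ι → ℂ} (c : ι → ℂ)
    (hc : ∏ a, c a = 1) (hv : Function.Injective v) {x : ℂ} (hx : ∀ i, x ≠ v i) :
    x * ∑ a, (1 - c a) * (∏ b ∈ univ.erase a, (v a - c b * v b))
        / (∏ b ∈ univ.erase a, (v a - v b)) / (x - v a)
      = (∏ b, (x - c b * v b)) / (∏ b, (x - v b)) - 1 := by
  have hne : ∏ l, (x - v l) ≠ 0 := prod_ne_zero_iff.2 fun l _ => sub_ne_zero.2 (hx l)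
  rcases isEmpty_or_nonempty ι with hι | hι
  · simp
  set A : ℂ[X] := Lagrange.nodal univ (fun b => c b * v b) with hA
  set B : ℂ[X] := Lagrange.nodal univ v with hB
  have hA' : ∀ t, A.eval t = ∏ b, (t - c b * v b) := fun t => Lagrange.eval_nodal
  have hB' : ∀ t, B.eval t = ∏ b, (t - v b) := fun t => Lagrange.eval_nodal
  have hAm : A.Monic := Lagrange.nodal_monic
  have hBm : B.Monic := Lagrange.nodal_monic
  have hAd : A.degree = (Fintype.card ι : ℕ) := by rw [hA, Lagrange.degree_nodal]; simp
  have hBd : B.degree = (Fintype.card ι : ℕ) := by rw [hB, Lagrange.degree_nodal]; simp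
  have hlt : (A - B).degree < (Fintype.card ι : ℕ) := by
    have := degree_sub_lt_left (hAd.trans hBd.symm) hAm.ne_zero
      (hAm.leadingCoeff.trans hBm.leadingCoeff.symm)
    rwa [hAd] at this
  have hroot : (A - B).eval 0 = 0 := by
    rw [eval_sub, hA', hB']
    simp only [zero_sub]
    rw [sub_eq_zero]
    calc ∏ b, -(c b * v b) = (∏ b, c b) * ∏ b, -v b := by
          rw [← prod_mul_distrib]; exact prod_congr rfl fun b _ => by ring
      _ = _ := by rw [hc, one_mul]
  obtain ⟨Q, hQ⟩ : X ∣ A - B := by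
    rw [X_dvd_iff, coeff_zero_eq_eval_zero, hroot]
  have hQd : Q.degree < (Fintype.card ι : ℕ) := by
    refine lt_of_le_of_lt ?_ hlt
    rw [hQ, mul_comm]
    exact degree_le_mul_left Q X_ne_zero
  have hnode : ∀ a, Q.eval (v a) = (1 - c a) * ∏ b ∈ univ.erase a, (v a - c b * v b) := by
    intro a
    by_cases h0 : v a = 0
    · have hAe : A = X * Lagrange.nodal (univ.erase a) (fun b => c b * v b) := by
        rw [hA, Lagrange.nodal_eq_mul_nodal_erase (mem_univ a)]
        simp [h0]
      have hBe : B = X * Lagrange.nodal (univ.erase a) v := by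
        rw [hB, Lagrange.nodal_eq_mul_nodal_erase (mem_univ a)]
        simp [h0]
      rw [hAe, hBe, ← mul_sub] at hQ
      rw [← mul_left_cancel₀ X_ne_zero hQ, eval_sub, Lagrange.eval_nodal, Lagrange.eval_nodal, h0]
      have h1 : ∏ b ∈ univ.erase a, (0 - c b * v b)
          = (∏ b ∈ univ.erase a, c b) * ∏ b ∈ univ.erase a, (0 - v b) := by
        rw [← prod_mul_distrib]; exact prod_congr rfl fun b _ => by ring
      rw [← mul_prod_erase univ c (mem_univ a)] at hc
      rw [h1]
      linear_combination (∏ b ∈ univ.erase a, (0 - v b)) * hc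
    · have h1 := congrArg (eval (v a)) hQ
      rw [eval_sub, hA', hB', prod_eq_zero (f := fun b => v a - v b) (mem_univ a) (sub_self (v a)),
        eval_mul, eval_X, ← mul_prod_erase univ _ (mem_univ a)] at h1
      apply mul_left_cancel₀ h0
      linear_combination -h1
  have h1 := lagrange_partial_fractions hv Q hQd hx
  simp only [hnode] at h1
  rw [h1]
  have h2 := congrArg (eval x) hQ
  rw [eval_sub, hA', hB', eval_mul, eval_X] at h2
  rw [← mul_div_assoc, ← h2, sub_div, div_self hne]

open Finset in
theorem prod_univ_erase_succAbove {n : ℕ} (i : Fin (n + 1)) (f : Fin (n + 1) → ℂ) :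
    ∏ b ∈ univ.erase i, f b = ∏ k, f (i.succAbove k) := by
  have : univ.erase i = univ.map (Fin.succAboveEmb i) := by
    rw [Fin.univ_succAbove n i, cons_eq_insert, erase_insert]
    simp
  rw [this, prod_map]
  rfl

/-- The sum of `∏ i, r i ^ y i` over strictly increasing `y : Fin n → ℕ`. -/
def geomChain : (n : ℕ) → (Fin n → ℂ) → ℂ
  | 0, _ => 1
  | n + 1, r => (∏ i : Fin n, r i.succ) * geomChain n (fun i => r i.succ) / (1 - ∏ i, r i)

/-- Splitting off the first entry of a strictly increasing sequence. -/
def strictMonoConsEquiv (n : ℕ) :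
    ℕ × {y : Fin n → ℕ // StrictMono y} ≃ {y : Fin (n + 1) → ℕ // StrictMono y} where
  toFun p := ⟨Fin.cons p.1 (fun i => p.2.1 i + p.1 + 1), by
    intro i j hij
    induction j using Fin.cases with
    | zero => exact absurd hij (Fin.not_lt_zero _)
    | succ j =>
      induction i using Fin.cases with
      | zero => simp only [Fin.cons_zero, Fin.cons_succ]; omega
      | succ i =>
        have := p.2.2 (Fin.succ_lt_succ_iff.1 hij)
        simp only [Fin.cons_succ]; omega⟩
  invFun y := (y.1 0, ⟨fun i => y.1 i.succ - y.1 0 - 1, by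
    intro i j hij
    have h1 := y.2 (Fin.succ_lt_succ_iff.2 hij)
    have h2 := y.2 (Fin.succ_pos i)
    simp only; omega⟩)
  left_inv p := by
    refine Prod.ext rfl (Subtype.ext (funext fun i => ?_))
    simp only [Fin.cons_zero, Fin.cons_succ]; omega
  right_inv y := by
    refine Subtype.ext (funext fun i => ?_)
    induction i using Fin.cases with
    | zero => rfl
    | succ i =>
      have h2 := y.2 (Fin.succ_pos i)
      simp only [Fin.cons_succ]; omega

theorem hasSum_geomChain (n : ℕ) (r : Fin n → ℂ) (hr : ∀ i, ‖r i‖ < 1) :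
    Summable (fun y : {y : Fin n → ℕ // StrictMono y} => ‖∏ i, r i ^ y.1 i‖) ∧
      HasSum (fun y : {y : Fin n → ℕ // StrictMono y} => ∏ i, r i ^ y.1 i) (geomChain n r) := by
  induction n with
  | zero =>
    have : Unique {y : Fin 0 → ℕ // StrictMono y} :=
      { default := ⟨Fin.elim0, fun i => i.elim0⟩
        uniq := fun y => Subtype.ext (Subsingleton.elim _ _) }
    refine ⟨(hasSum_fintype _).summable, ?_⟩
    simp [geomChain]
  | succ n ih =>
    obtain ⟨ih1, ih2⟩ := ih (fun i => r i.succ) (fun i => hr i.succ)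
    have hR : ‖∏ i, r i‖ < 1 := by
      rw [norm_prod, Fin.prod_univ_succ]
      calc ‖r 0‖ * ∏ i : Fin n, ‖r i.succ‖ ≤ ‖r 0‖ * 1 := by
            refine mul_le_mul_of_nonneg_left ?_ (norm_nonneg _)
            exact Finset.prod_le_one (fun i _ => norm_nonneg _) (fun i _ => (hr _).le)
        _ < 1 := by simpa using hr 0
    have hfun : (fun y : {y : Fin (n + 1) → ℕ // StrictMono y} => ∏ i, r i ^ y.1 i)
        ∘ strictMonoConsEquiv n = fun p => (∏ i, r i) ^ p.1
          * ((∏ i : Fin n, r i.succ) * ∏ i : Fin n, r i.succ ^ p.2.1 i) := by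
      funext p
      simp only [Function.comp, strictMonoConsEquiv, Equiv.coe_fn_mk, Fin.prod_univ_succ,
        Fin.cons_zero, Fin.cons_succ, pow_add, pow_one, Finset.prod_mul_distrib,
        Finset.prod_pow, mul_pow]
      ring
    have hg1 : Summable fun k : ℕ => ‖(∏ i, r i) ^ k‖ := by
      simpa only [norm_pow] using summable_geometric_of_lt_one (norm_nonneg _) hR
    have hg2 := hasSum_geometric_of_norm_lt_one hR
    have hs1 : Summable fun y : {y : Fin n → ℕ // StrictMono y} =>
        ‖(∏ i : Fin n, r i.succ) * ∏ i : Fin n, r i.succ ^ y.1 i‖ := by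
      simpa only [norm_mul] using ih1.mul_left ‖∏ i : Fin n, r i.succ‖
    have hs2 := ih2.mul_left (∏ i : Fin n, r i.succ)
    refine ⟨?_, ?_⟩
    · rw [← (strictMonoConsEquiv n).summable_iff]
      have := hg1.mul_norm hs1
      convert this using 1
      funext p
      exact congrArg norm (congrFun hfun p)
    · rw [← (strictMonoConsEquiv n).hasSum_iff, hfun]
      have h1 := summable_mul_of_summable_norm hg1 hs1
      have h2 := hg2.mul hs2 h1
      have h3 : geomChain (n + 1) r = (1 - ∏ i, r i)⁻¹
          * ((∏ i : Fin n, r i.succ) * geomChain n fun i => r i.succ) := by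
        rw [geomChain, div_eq_inv_mul]
      rw [h3]
      exact h2

open Finset in
theorem prod_pairs_succ {n : ℕ} (f : Fin (n + 1) → Fin (n + 1) → ℂ) :
    ∏ p ∈ univ.filter (fun p : Fin (n + 1) × Fin (n + 1) => p.1 < p.2), f p.1 p.2
      = (∏ k : Fin n, f 0 k.succ)
        * ∏ p ∈ univ.filter (fun p : Fin n × Fin n => p.1 < p.2), f p.1.succ p.2.succ := by
  simp only [prod_filter, Fintype.prod_prod_type, Fin.prod_univ_succ (n := n)]
  simp

open Finset in
theorem prod_pairs_eq_det_vandermonde {n : ℕ} (w : Fin n → ℂ) :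
    ∏ p ∈ univ.filter (fun p : Fin n × Fin n => p.1 < p.2), (w p.2 - w p.1)
      = (Matrix.vandermonde w).det := by
  rw [Matrix.det_vandermonde, prod_filter, Fintype.prod_prod_type]
  refine prod_congr rfl fun i _ => ?_
  rw [← prod_filter]
  refine prod_congr ?_ fun _ _ => rfl
  ext j
  simp

theorem vandP_eq_det_vandermonde {n : ℕ} (z : Fin n → ℂ) :
    vandP z = (Matrix.vandermonde fun i => -z i).det := by
  rw [← prod_pairs_eq_det_vandermonde, vandP]
  exact Finset.prod_congr rfl fun p _ => by ring

theorem det_vandermonde_succAbove {n : ℕ} (w : Fin (n + 1) → ℂ) (i : Fin (n + 1)) :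
    (Matrix.vandermonde w).det = (-1) ^ (i : ℕ) * (∏ k, (w (i.succAbove k) - w i))
      * (Matrix.vandermonde fun k => w (i.succAbove k)).det := by
  have h := Matrix.det_permute i.cycleRange.symm (Matrix.vandermonde w)
  rw [Equiv.Perm.sign_symm, Fin.sign_cycleRange] at h
  have h2 : (Matrix.vandermonde w).submatrix i.cycleRange.symm id
      = Matrix.vandermonde (fun k => w (i.cycleRange.symm k)) := rfl
  rw [h2, ← prod_pairs_eq_det_vandermonde,
    prod_pairs_succ fun a b => w (i.cycleRange.symm b) - w (i.cycleRange.symm a)] at h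
  simp only [Fin.cycleRange_symm_zero, Fin.cycleRange_symm_succ] at h
  rw [prod_pairs_eq_det_vandermonde fun k => w (i.succAbove k)] at h
  push_cast at h
  have h3 : ((-1 : ℂ) ^ (i : ℕ)) * (-1) ^ (i : ℕ) = 1 := by
    rw [← mul_pow]; norm_num
  rw [mul_assoc, h, ← mul_assoc, h3, one_mul]

theorem sum_perm_succAbove {n : ℕ} (f : Equiv.Perm (Fin (n + 1)) → ℂ) :
    ∑ σ, f σ = ∑ i : Fin (n + 1), ∑ e : Equiv.Perm (Fin n),
      f ((Equiv.Perm.decomposeFin.symm (0, e)).trans i.cycleRange.symm) := by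
  rw [← Fintype.sum_prod_type' fun (i : Fin (n + 1)) (e : Equiv.Perm (Fin n)) =>
    f ((Equiv.Perm.decomposeFin.symm (0, e)).trans i.cycleRange.symm)]
  symm
  refine Function.Bijective.sum_comp (e := fun p : Fin (n + 1) × Equiv.Perm (Fin n) =>
    (Equiv.Perm.decomposeFin.symm (0, p.2)).trans p.1.cycleRange.symm) ?_ f
  rw [Fintype.bijective_iff_injective_and_card]
  refine ⟨?_, by simpa using (Fintype.card_congr (Equiv.Perm.decomposeFin (n := n))).symm⟩
  rintro ⟨i, e⟩ ⟨j, d⟩ h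
  simp only at h
  have h0 := Equiv.congr_fun h 0
  simp only [Equiv.trans_apply, Equiv.Perm.decomposeFin_symm_apply_zero,
    Fin.cycleRange_symm_zero] at h0
  subst h0
  refine Prod.ext rfl (Equiv.ext fun x => ?_)
  have hx := Equiv.congr_fun h x.succ
  simpa [Equiv.trans_apply] using hx

/-- The double symmetrisation of `geomChain` which the sum over `x` of the products of
eigenfunctions amounts to. -/
def symSum (q : ℂ) (n : ℕ) (z w : Fin n → ℂ) : ℂ :=
  ∑ σ : Equiv.Perm (Fin n), ∑ τ : Equiv.Perm (Fin n),
    (∏ p ∈ Finset.univ.filter (fun p : Fin n × Fin n => p.1 < p.2),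
      (z (σ p.1) - q * z (σ p.2)) / (z (σ p.1) - z (σ p.2)))
    * (∏ p ∈ Finset.univ.filter (fun p : Fin n × Fin n => p.1 < p.2),
      (q * w (τ p.1) - w (τ p.2)) / (w (τ p.1) - w (τ p.2)))
    * geomChain n (fun i => ((1 - w (τ i)) / (1 - w (τ i) / q))
        / ((1 - z (σ i)) / (1 - z (σ i) / q)))

theorem symSum_succ (q : ℂ) (n : ℕ) (z w : Fin (n + 1) → ℂ) :
    symSum q (n + 1) z w = ∑ i, ∑ j,
      (∏ k, (z i - q * z (i.succAbove k)) / (z i - z (i.succAbove k)))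
      * (∏ k, (q * w j - w (j.succAbove k)) / (w j - w (j.succAbove k)))
      * ((∏ k, (1 - w (j.succAbove k)) / (1 - w (j.succAbove k) / q))
        / (∏ k, (1 - z (i.succAbove k)) / (1 - z (i.succAbove k) / q)))
      / (1 - (∏ k, (1 - w k) / (1 - w k / q)) / (∏ k, (1 - z k) / (1 - z k / q)))
      * symSum q n (fun k => z (i.succAbove k)) (fun k => w (j.succAbove k)) := by
  rw [symSum, sum_perm_succAbove]
  refine Finset.sum_congr rfl fun i _ => ?_
  simp_rw [sum_perm_succAbove (n := n)]
  rw [Finset.sum_comm]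
  refine Finset.sum_congr rfl fun j _ => ?_
  rw [symSum, Finset.mul_sum]
  refine Finset.sum_congr rfl fun e _ => ?_
  rw [Finset.mul_sum]
  refine Finset.sum_congr rfl fun d _ => ?_
  set σ := (Equiv.Perm.decomposeFin.symm (0, e)).trans i.cycleRange.symm with hσ
  set τ := (Equiv.Perm.decomposeFin.symm (0, d)).trans j.cycleRange.symm with hτ
  have hσ0 : σ 0 = i := by simp [hσ]
  have hτ0 : τ 0 = j := by simp [hτ]
  have hσs : ∀ k : Fin n, σ k.succ = i.succAbove (e k) := fun k => by simp [hσ]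
  have hτs : ∀ k : Fin n, τ k.succ = j.succAbove (d k) := fun k => by simp [hτ]
  rw [prod_pairs_succ fun a b => (z (σ a) - q * z (σ b)) / (z (σ a) - z (σ b)),
    prod_pairs_succ fun a b => (q * w (τ a) - w (τ b)) / (w (τ a) - w (τ b)), geomChain]
  simp only [hσ0, hτ0, hσs, hτs, Finset.prod_div_distrib (ι := Fin n) (f := fun k =>
    (1 - w (j.succAbove (d k))) / (1 - w (j.succAbove (d k)) / q))]
  rw [Finset.prod_div_distrib (f := fun k => (1 - w (τ k)) / (1 - w (τ k) / q)),
    Equiv.prod_comp τ fun k => (1 - w k) / (1 - w k / q),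
    Equiv.prod_comp σ fun k => (1 - z k) / (1 - z k / q),
    Equiv.prod_comp e fun k => (z i - q * z (i.succAbove k)) / (z i - z (i.succAbove k)),
    Equiv.prod_comp d fun k => (q * w j - w (j.succAbove k)) / (w j - w (j.succAbove k)),
    Equiv.prod_comp d fun k => (1 - w (j.succAbove k)) / (1 - w (j.succAbove k) / q),
    Equiv.prod_comp e fun k => (1 - z (i.succAbove k)) / (1 - z (i.succAbove k) / q)]
  ring

theorem prod_fin_const_mul {n : ℕ} (c : ℂ) (f : Fin n → ℂ) :
    ∏ k, c * f k = c ^ n * ∏ k, f k := by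
  simp [Finset.prod_mul_distrib]

theorem prod_fin_div_const {n : ℕ} (c : ℂ) (f : Fin n → ℂ) :
    ∏ k, f k / c = (∏ k, f k) / c ^ n := by
  simp

open Finset Polynomial in
theorem sum_cauchy_mul_alpha {q : ℂ} (hq : q ≠ 0) {n : ℕ} {z w : Fin (n + 1) → ℂ}
    (hw : Function.Injective w) (hzw : ∀ i j, z i ≠ w j) (hzqw : ∀ i j, z i ≠ q * w j)
    (i : Fin (n + 1)) :
    ∑ j, 1 / ((z i - w j) * (z i - q * w j))
        * ((∏ k, (w j - z k)) / ∏ k, (w j - w (j.succAbove k)))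
      = -((∏ k, (z i - q * z (i.succAbove k))) / ∏ l, (z i - q * w l)) := by
  have hx : ∀ j, z i / q ≠ w j := fun j h => hzqw i j (by rw [← h]; field_simp)
  have hscale : ∀ a, z i / q - a = (z i - q * a) / q := fun a => by field_simp
  have h := lagrange_partial_fractions hw (Lagrange.nodal (univ.erase i) z) (by
    rw [Lagrange.degree_nodal, card_erase_of_mem (mem_univ i)]
    simp only [card_univ, Fintype.card_fin]
    exact_mod_cast Nat.lt_succ_self n) hx
  simp only [Lagrange.eval_nodal, prod_univ_erase_succAbove, hscale, prod_fin_div_const] at h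
  have hne : ∏ l, (z i - q * w l) ≠ 0 :=
    prod_ne_zero_iff.2 fun l _ => sub_ne_zero.2 (hzqw i l)
  have h2 : ∀ j, 1 / ((z i - w j) * (z i - q * w j))
        * ((∏ k, (w j - z k)) / ∏ k, (w j - w (j.succAbove k)))
      = -(1 / q) * ((∏ k, (w j - z (i.succAbove k))) / (∏ k, (w j - w (j.succAbove k)))
        / ((z i - q * w j) / q)) := by
    intro j
    have h3 : ∏ k, (w j - w (j.succAbove k)) ≠ 0 := prod_ne_zero_iff.2 fun k _ =>
      sub_ne_zero.2 fun h => (Fin.succAbove_ne j k) (hw h).symm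
    have h4 := sub_ne_zero.2 (hzw i j)
    have h5 := sub_ne_zero.2 (hzqw i j)
    rw [Fin.prod_univ_succAbove _ i]
    field_simp
    ring
  simp only [h2]
  rw [← mul_sum, h]
  field_simp
  ring

open Finset Polynomial in
theorem sum_beta_mul_cauchy {q : ℂ} {n : ℕ} {z w : Fin (n + 1) → ℂ}
    (hz : Function.Injective z) (hzw : ∀ i j, z i ≠ w j) (hzqw : ∀ i j, z i ≠ q * w j)
    (j : Fin (n + 1)) :
    ∑ i, ((∏ l, (z i - w l)) / ∏ k, (z i - z (i.succAbove k)))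
        * (1 / ((z i - w j) * (z i - q * w j)))
      = (-1) ^ n * ((∏ k, (q * w j - w (j.succAbove k))) / ∏ k, (z k - q * w j)) := by
  have h := lagrange_partial_fractions hz (Lagrange.nodal (univ.erase j) w) (by
    rw [Lagrange.degree_nodal, card_erase_of_mem (mem_univ j)]
    simp only [card_univ, Fintype.card_fin]
    exact_mod_cast Nat.lt_succ_self n) (x := q * w j) (fun i => (hzqw i j).symm)
  simp only [Lagrange.eval_nodal, prod_univ_erase_succAbove] at h
  have h2 : ∀ i, ((∏ l, (z i - w l)) / ∏ k, (z i - z (i.succAbove k)))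
        * (1 / ((z i - w j) * (z i - q * w j)))
      = -((∏ k, (z i - w (j.succAbove k))) / (∏ k, (z i - z (i.succAbove k)))
        / (q * w j - z i)) := by
    intro i
    have h3 : ∏ k, (z i - z (i.succAbove k)) ≠ 0 := prod_ne_zero_iff.2 fun k _ =>
      sub_ne_zero.2 fun h => (Fin.succAbove_ne i k) (hz h).symm
    have h4 := sub_ne_zero.2 (hzw i j)
    have h5 := sub_ne_zero.2 (hzqw i j)
    rw [Fin.prod_univ_succAbove _ j, ← neg_sub (z i) (q * w j), div_neg, neg_neg]
    field_simp
  simp only [h2]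
  have h7 : ∏ k, (q * w j - z k) = (-1) ^ (n + 1) * ∏ k, (z k - q * w j) := by
    rw [← prod_fin_const_mul]
    exact prod_congr rfl fun k _ => by ring
  rw [sum_neg_distrib, h, h7]
  rcases neg_one_pow_eq_or ℂ n with hs | hs <;> simp [pow_succ, hs, div_neg]

open Finset in
theorem sum_residues_eq {q : ℂ} (hq : q ≠ 0) {n : ℕ} {z w : Fin (n + 1) → ℂ}
    (hz : Function.Injective z) (hw : Function.Injective w)
    (hzqw : ∀ i j, z i ≠ q * w j) (hzq : ∀ i, z i ≠ q) (hw1 : ∀ j, w j ≠ 1) :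
    (1 - q) * ((-1) ^ n * ∑ j, (∏ k, (q * w j - w (j.succAbove k))) / (∏ k, (z k - q * w j))
          / (1 - w j) * ((∏ k, (w j - z k)) / ∏ k, (w j - w (j.succAbove k)))
        + ∑ i, ((∏ l, (z i - w l)) / ∏ k, (z i - z (i.succAbove k)))
          * ((∏ k, (z i - q * z (i.succAbove k))) / (∏ l, (z i - q * w l)) / (1 - z i / q)))
      = (∏ k, (1 - w k / q)) * (∏ k, (1 - z k)) / ((∏ k, (1 - w k)) * ∏ k, (1 - z k / q))
        - 1 := by
  have hinj : Function.Injective (Sum.elim w fun i => z i / q) := by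
    refine Function.Injective.sumElim hw (fun a b h => hz ?_) fun a b h => hzqw b a ?_
    · field_simp at h; exact h
    · rw [h]; field_simp
  have hx : ∀ a, (1 : ℂ) ≠ Sum.elim w (fun i => z i / q) a := by
    rintro (a | a)
    · exact (hw1 a).symm
    · intro h
      apply hzq a
      simp only [Sum.elim_inr] at h
      field_simp at h
      exact h.symm
  have h := sum_dilation_residues
    (Sum.elim (fun _ : Fin (n + 1) => 1 / q) (fun _ : Fin (n + 1) => q)) (by
      simp [Fintype.prod_sum_type, hq]) hinj hx
  have he1 : ∀ (j : Fin (n + 1)) (f : Fin (n + 1) ⊕ Fin (n + 1) → ℂ),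
      ∏ b ∈ univ.erase (Sum.inl j), f b
        = (∏ k, f (Sum.inl (j.succAbove k))) * ∏ k, f (Sum.inr k) := by
    intro j f
    rw [← prod_univ_erase_succAbove j fun b => f (Sum.inl b)]
    have : (univ : Finset (Fin (n + 1) ⊕ Fin (n + 1))).erase (Sum.inl j)
        = (univ.erase j).disjSum univ := by
      ext (a | a) <;> simp
    rw [this, prod_disjSum]
  have he2 : ∀ (j : Fin (n + 1)) (f : Fin (n + 1) ⊕ Fin (n + 1) → ℂ),
      ∏ b ∈ univ.erase (Sum.inr j), f b
        = (∏ k, f (Sum.inl k)) * ∏ k, f (Sum.inr (j.succAbove k)) := by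
    intro j f
    rw [← prod_univ_erase_succAbove j fun b => f (Sum.inr b)]
    have : (univ : Finset (Fin (n + 1) ⊕ Fin (n + 1))).erase (Sum.inr j)
        = univ.disjSum (univ.erase j) := by
      ext (a | a) <;> simp
    rw [this, prod_disjSum]
  simp only [Fintype.sum_sum_type, Fintype.prod_sum_type, he1, he2, Sum.elim_inl,
    Sum.elim_inr, one_mul] at h
  have hcanc : ∀ a, q * (a / q) = a := fun a => by field_simp
  have hinv : ∀ a, 1 / q * a = a / q := fun a => by ring
  simp only [hcanc, hinv] at h
  rw [← h, mul_add, mul_sum, mul_sum, mul_sum]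
  congr 1
  · refine sum_congr rfl fun j _ => ?_
    have h1 : ∏ k, (w j - w (j.succAbove k) / q)
        = (∏ k, (q * w j - w (j.succAbove k))) / q ^ n := by
      rw [← prod_fin_div_const]
      exact prod_congr rfl fun k _ => by field_simp
    have h2 : ∏ k, (w j - z k / q) = (-1 / q) ^ (n + 1) * ∏ k, (z k - q * w j) := by
      rw [← prod_fin_const_mul]
      exact prod_congr rfl fun k _ => by field_simp; ring
    rw [h1, h2]
    have h3 : ∏ k, (z k - q * w j) ≠ 0 :=
      prod_ne_zero_iff.2 fun l _ => sub_ne_zero.2 (hzqw l j)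
    have h4 : ∏ k, (w j - w (j.succAbove k)) ≠ 0 := prod_ne_zero_iff.2 fun k _ =>
      sub_ne_zero.2 fun h => (Fin.succAbove_ne j k) (hw h).symm
    have h5 : 1 - w j ≠ 0 := sub_ne_zero.2 (hw1 j).symm
    rw [div_pow]
    rcases neg_one_pow_eq_or ℂ n with hs | hs <;> simp only [pow_succ, hs] <;> field_simp <;> ring
  · refine sum_congr rfl fun i _ => ?_
    have h1 : ∏ k, (z i / q - w k / q) = (∏ k, (z i - w k)) / q ^ (n + 1) := by
      rw [← prod_fin_div_const]
      exact prod_congr rfl fun k _ => by field_simp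
    have h2 : ∏ k, (z i / q - w k) = (∏ k, (z i - q * w k)) / q ^ (n + 1) := by
      rw [← prod_fin_div_const]
      exact prod_congr rfl fun k _ => by field_simp
    have h3 : ∏ k, (z i / q - z (i.succAbove k) / q)
        = (∏ k, (z i - z (i.succAbove k))) / q ^ n := by
      rw [← prod_fin_div_const]
      exact prod_congr rfl fun k _ => by field_simp
    have h4 : ∏ k, (z i / q - z (i.succAbove k))
        = (∏ k, (z i - q * z (i.succAbove k))) / q ^ n := by
      rw [← prod_fin_div_const]
      exact prod_congr rfl fun k _ => by field_simp
    rw [h1, h2, h3, h4]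
    have h5 : ∏ k, (z i - q * w k) ≠ 0 :=
      prod_ne_zero_iff.2 fun l _ => sub_ne_zero.2 (hzqw i l)
    have h6 : ∏ k, (z i - z (i.succAbove k)) ≠ 0 := prod_ne_zero_iff.2 fun k _ =>
      sub_ne_zero.2 fun h => (Fin.succAbove_ne i k) (hz h).symm
    have h7 : 1 - z i / q ≠ 0 := sub_ne_zero.2 (by simpa using hx (Sum.inr i))
    field_simp

theorem one_sub_div_ne_zero {a q : ℂ} (hq : q ≠ 0) (ha : a ≠ q) : 1 - a / q ≠ 0 :=
  sub_ne_zero.2 fun h => ha ((div_eq_one_iff_eq hq).1 h.symm)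

/-- The Izergin–Korepin matrix. -/
def ikMatrix (q : ℂ) {n : ℕ} (z w : Fin n → ℂ) : Matrix (Fin n) (Fin n) ℂ :=
  Matrix.of fun i j => 1 / ((z i - w j) * (z i - q * w j))

/-- The prefactor of the Izergin–Korepin determinant in the summation identity. -/
def ikPrefactor (q : ℂ) (n : ℕ) (z w : Fin n → ℂ) : ℂ :=
  (∏ j, (1 - z j) * (1 - w j / q)) * (1 / q - 1) ^ (-(n : ℤ))
    * ((∏ i, ∏ j, (z i - q * w j)) / (vandP z * (Matrix.vandermonde w).det))

open Finset in
/-- The bilinear form of the adjugate of the Izergin–Korepin matrix behind the recursion. -/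
theorem sum_adjugate_ikMatrix {q : ℂ} (hq : q ≠ 0) {n : ℕ} {z w : Fin (n + 1) → ℂ}
    (hz : Function.Injective z) (hw : Function.Injective w) (hzw : ∀ i j, z i ≠ w j)
    (hzqw : ∀ i j, z i ≠ q * w j) (hzq : ∀ i, z i ≠ q) (hw1 : ∀ j, w j ≠ 1) :
    (1 / q - 1) * (-1) ^ n * ∑ i, ∑ j,
        ((∏ k, (z i - q * z (i.succAbove k))) / (∏ l, (z i - q * w l)) / (1 - z i / q))
        * ((∏ k, (q * w j - w (j.succAbove k))) / (∏ k, (z k - q * w j)) / (1 - w j))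
        * (z i - q * w j) * (ikMatrix q z w).adjugate j i
      = (ikMatrix q z w).det
        * ((∏ k, (1 - w k / q)) * (∏ k, (1 - z k)) / ((∏ k, (1 - w k)) * ∏ k, (1 - z k / q))
          - 1) := by
  set M := ikMatrix q z w with hM
  set α : Fin (n + 1) → ℂ := fun j => (∏ k, (w j - z k)) / ∏ k, (w j - w (j.succAbove k))
    with hα
  set β : Fin (n + 1) → ℂ := fun i => (∏ l, (z i - w l)) / ∏ k, (z i - z (i.succAbove k))
    with hβ
  set U : Fin (n + 1) → ℂ := fun i =>
    (∏ k, (z i - q * z (i.succAbove k))) / ∏ l, (z i - q * w l) with hU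
  set V : Fin (n + 1) → ℂ := fun j =>
    (∏ k, (q * w j - w (j.succAbove k))) / ∏ k, (z k - q * w j) with hV
  have hMα : M.mulVec α = -U := by
    funext i
    exact sum_cauchy_mul_alpha hq hw hzw hzqw i
  have hβM : Matrix.vecMul β M = (-1 : ℂ) ^ n • V := by
    funext j
    have := sum_beta_mul_cauchy hz hzw hzqw j
    simpa [Matrix.vecMul, dotProduct, hM, ikMatrix] using this
  have h1 : ∀ j, ∑ i, M.adjugate j i * U i = -(M.det * α j) := by
    intro j
    have h := congrFun (congrArg M.adjugate.mulVec hMα) j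
    rw [Matrix.mulVec_mulVec, Matrix.adjugate_mul, Matrix.mulVec_neg, Matrix.smul_mulVec,
      Matrix.one_mulVec] at h
    simp only [Pi.smul_apply, Pi.neg_apply, smul_eq_mul, Matrix.mulVec, dotProduct] at h
    linear_combination h
  have h2 : ∀ i, ∑ j, V j * M.adjugate j i = (-1) ^ n * (M.det * β i) := by
    intro i
    have h := congrFun (congrArg (fun x => Matrix.vecMul x M.adjugate) hβM) i
    simp only [Matrix.vecMul_vecMul, Matrix.mul_adjugate, Matrix.vecMul_smul,
      Matrix.smul_vecMul, Matrix.vecMul_one, Pi.smul_apply, smul_eq_mul] at h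
    simp only [Matrix.vecMul, dotProduct] at h
    have h3 : ((-1 : ℂ) ^ n) * (-1) ^ n = 1 := by
      rw [← mul_pow]; norm_num
    rw [h, ← mul_assoc, h3, one_mul]
  have hterm : ∀ i j, U i / (1 - z i / q) * (V j / (1 - w j)) * (z i - q * w j)
        * M.adjugate j i
      = q * (U i / (1 - z i / q) * (V j * M.adjugate j i))
        - q * (V j / (1 - w j) * (M.adjugate j i * U i)) := by
    intro i j
    have h3 : 1 - z i / q ≠ 0 := one_sub_div_ne_zero hq (hzq i)
    have h4 : 1 - w j ≠ 0 := sub_ne_zero.2 (hw1 j).symm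
    have h5 : U i / (1 - z i / q) * (1 - z i / q) = U i := div_mul_cancel₀ _ h3
    have h6 : V j / (1 - w j) * (1 - w j) = V j := div_mul_cancel₀ _ h4
    have h7 : z i - q * w j = q * (1 - w j) - q * (1 - z i / q) := by field_simp; ring
    rw [h7]
    linear_combination (q * U i / (1 - z i / q) * M.adjugate j i) * h6
      - (q * V j / (1 - w j) * M.adjugate j i) * h5
  have hsum : ∑ i, ∑ j, U i / (1 - z i / q) * (V j / (1 - w j)) * (z i - q * w j)
        * M.adjugate j i
      = q * M.det * ((-1) ^ n * (∑ i, β i * (U i / (1 - z i / q)))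
        + ∑ j, V j / (1 - w j) * α j) := by
    simp only [hterm, sum_sub_distrib, ← mul_sum]
    rw [sum_comm (f := fun i j => V j / (1 - w j) * (M.adjugate j i * U i))]
    simp only [← mul_sum, h1, h2]
    simp only [mul_sum, mul_add, ← sum_sub_distrib, ← sum_add_distrib]
    refine sum_congr rfl fun i _ => ?_
    ring
  have hfin := sum_residues_eq hq hz hw hzqw hzq hw1
  rw [hsum, ← hfin]
  have h3 : ((-1 : ℂ) ^ n) * (-1) ^ n = 1 := by
    rw [← mul_pow]; norm_num
  have h4 : (1 / q - 1) * q = 1 - q := by field_simp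
  linear_combination ((-1) ^ n * M.det * ((-1) ^ n * (∑ i, β i * (U i / (1 - z i / q)))
        + ∑ j, V j / (1 - w j) * α j)) * h4
    + (1 - q) * M.det * (∑ i, β i * (U i / (1 - z i / q))) * h3

open Finset in
theorem ikPrefactor_succAbove {q : ℂ} (hq : q ≠ 0) (hq1 : q ≠ 1) {n : ℕ}
    {z w : Fin (n + 1) → ℂ} (hz : Function.Injective z) (hw : Function.Injective w)
    (hzqw : ∀ i j, z i ≠ q * w j) (hz1 : ∀ i, z i ≠ 1) (hwq : ∀ j, w j ≠ q)
    (i j : Fin (n + 1)) :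
    (∏ k, (z i - q * z (i.succAbove k)) / (z i - z (i.succAbove k)))
      * (∏ k, (q * w j - w (j.succAbove k)) / (w j - w (j.succAbove k)))
      * ikPrefactor q n (fun k => z (i.succAbove k)) (fun k => w (j.succAbove k))
      = ikPrefactor q (n + 1) z w * ((1 / q - 1) * (-1) ^ n) * (-1) ^ ((i : ℕ) + (j : ℕ))
        * ((∏ k, (z i - q * z (i.succAbove k))) / (∏ l, (z i - q * w l)) / (1 - z i))
        * ((∏ k, (q * w j - w (j.succAbove k))) / (∏ k, (z k - q * w j)) / (1 - w j / q))
        * (z i - q * w j) := by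
  have ha2 : ∏ k, (z i - z (i.succAbove k)) ≠ 0 := prod_ne_zero_iff.2 fun k _ =>
    sub_ne_zero.2 fun h => (Fin.succAbove_ne i k) (hz h).symm
  have hb2 : ∏ k, (w j - w (j.succAbove k)) ≠ 0 := prod_ne_zero_iff.2 fun k _ =>
    sub_ne_zero.2 fun h => (Fin.succAbove_ne j k) (hw h).symm
  have hV : vandP (fun k => z (i.succAbove k)) ≠ 0 := by
    rw [vandP_eq_det_vandermonde]
    exact Matrix.det_vandermonde_ne_zero_iff.2 fun a b h =>
      i.succAbove_right_injective (hz (neg_injective h))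
  have hW : (Matrix.vandermonde fun k => w (j.succAbove k)).det ≠ 0 :=
    Matrix.det_vandermonde_ne_zero_iff.2 fun a b h => j.succAbove_right_injective (hw h)
  have hsplit : ∏ a, ∏ b, (z a - q * w b) = (z i - q * w j)
      * (∏ k, (z i - q * w (j.succAbove k))) * ((∏ k, (z (i.succAbove k) - q * w j))
      * ∏ a, ∏ b, (z (i.succAbove a) - q * w (j.succAbove b))) := by
    rw [Fin.prod_univ_succAbove _ i, Fin.prod_univ_succAbove _ j, ← prod_mul_distrib]
    congr 1
    exact prod_congr rfl fun a _ => Fin.prod_univ_succAbove _ j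
  have hvz : vandP z = (-1) ^ (i : ℕ) * (∏ k, (z i - z (i.succAbove k)))
      * vandP (fun k => z (i.succAbove k)) := by
    rw [vandP_eq_det_vandermonde, vandP_eq_det_vandermonde, det_vandermonde_succAbove _ i]
    congr 2
    exact prod_congr rfl fun k _ => by ring
  have hvw : (Matrix.vandermonde w).det = (-1) ^ (j : ℕ)
      * ((-1) ^ n * ∏ k, (w j - w (j.succAbove k)))
      * (Matrix.vandermonde fun k => w (j.succAbove k)).det := by
    rw [det_vandermonde_succAbove w j, ← prod_fin_const_mul]
    congr 2
    exact prod_congr rfl fun k _ => by ring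
  have hd0 : z i - q * w j ≠ 0 := sub_ne_zero.2 (hzqw i j)
  have hd1 : ∏ k, (z i - q * w (j.succAbove k)) ≠ 0 :=
    prod_ne_zero_iff.2 fun k _ => sub_ne_zero.2 (hzqw _ _)
  have hd2 : ∏ k, (z (i.succAbove k) - q * w j) ≠ 0 :=
    prod_ne_zero_iff.2 fun k _ => sub_ne_zero.2 (hzqw _ _)
  have hq' : 1 / q - 1 ≠ 0 := by
    rw [sub_ne_zero]
    intro h
    apply hq1
    field_simp at h
    exact h.symm
  have hzi : 1 - z i ≠ 0 := sub_ne_zero.2 (hz1 i).symm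
  have hwj : 1 - w j / q ≠ 0 := one_sub_div_ne_zero hq (hwq j)
  simp only [ikPrefactor]
  rw [hsplit, hvz, hvw, Fin.prod_univ_succAbove (fun j => (1 - z j) * (1 - w j / q)) i]
  rw [prod_mul_distrib (f := fun k => 1 - z (i.succAbove k))
    (g := fun k => 1 - w (i.succAbove k) / q),
    prod_mul_distrib (f := fun k => 1 - z (i.succAbove k))
    (g := fun k => 1 - w (j.succAbove k) / q), prod_div_distrib, prod_div_distrib,
    Fin.prod_univ_succAbove (fun l => z i - q * w l) j,
    Fin.prod_univ_succAbove (fun k => z k - q * w j) i]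
  have hwsplit : (1 - w i / q) * ∏ k, (1 - w (i.succAbove k) / q)
      = (1 - w j / q) * ∏ k, (1 - w (j.succAbove k) / q) := by
    rw [← Fin.prod_univ_succAbove (fun k => 1 - w k / q),
      ← Fin.prod_univ_succAbove (fun k => 1 - w k / q)]
  have hcomb : (1 - z i) * (1 - w i / q) * ((∏ k, (1 - z (i.succAbove k)))
        * ∏ k, (1 - w (i.succAbove k) / q))
      = (1 - z i) * (∏ k, (1 - z (i.succAbove k))) * ((1 - w j / q)
        * ∏ k, (1 - w (j.succAbove k) / q)) := by
    rw [← hwsplit]; ring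
  have hpow : (1 / q - 1) ^ (-((n + 1 : ℕ) : ℤ))
      = (1 / q - 1) ^ (-(n : ℤ)) / (1 / q - 1) := by
    rw [div_eq_mul_inv (_ ^ _), ← zpow_sub_one₀ hq']
    congr 1
    push_cast; ring
  rw [hcomb, hpow, pow_add]
  generalize (1 / q - 1) ^ (-(n : ℤ)) = Y
  generalize 1 / q - 1 = y at *
  generalize 1 - w j / q = ηj at *
  generalize (∏ k, (z i - z (i.succAbove k))) = a2 at *
  generalize (∏ k, (w j - w (j.succAbove k))) = b2 at *
  generalize (∏ k, (z i - q * w (j.succAbove k))) = d1 at *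
  generalize (∏ k, (z (i.succAbove k) - q * w j)) = d2 at *
  generalize vandP (fun k => z (i.succAbove k)) = vz at *
  generalize (Matrix.vandermonde fun k => w (j.succAbove k)).det = vw at *
  rcases neg_one_pow_eq_or ℂ n with hs | hs <;>
  rcases neg_one_pow_eq_or ℂ (i : ℕ) with hi | hi <;>
  rcases neg_one_pow_eq_or ℂ (j : ℕ) with hj | hj <;>
  rw [hs, hi, hj] <;> field_simp

theorem norm_prod_div_lt_one {n : ℕ} {f g : Fin (n + 1) → ℂ}
    (h : ∀ i j, ‖f j / g i‖ < 1) : ‖(∏ k, f k) / ∏ k, g k‖ < 1 := by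
  rw [← Finset.prod_div_distrib, norm_prod, Fin.prod_univ_succ]
  calc ‖f 0 / g 0‖ * ∏ i : Fin n, ‖f i.succ / g i.succ‖ ≤ ‖f 0 / g 0‖ * 1 := by
        refine mul_le_mul_of_nonneg_left ?_ (norm_nonneg _)
        exact Finset.prod_le_one (fun i _ => norm_nonneg _) (fun i _ => (h _ _).le)
    _ < 1 := by simpa using h 0 0

open Finset in
theorem symSum_eq_det {q : ℂ} (hq : q ≠ 0) (hq1 : q ≠ 1) (n : ℕ) (z w : Fin n → ℂ)
    (hz : Function.Injective z) (hw : Function.Injective w) (hzw : ∀ i j, z i ≠ w j)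
    (hzqw : ∀ i j, z i ≠ q * w j) (hz1 : ∀ i, z i ≠ 1) (hzq : ∀ i, z i ≠ q)
    (hw1 : ∀ j, w j ≠ 1) (hwq : ∀ j, w j ≠ q)
    (hnorm : ∀ i j, ‖((1 - w j) / (1 - w j / q)) / ((1 - z i) / (1 - z i / q))‖ < 1) :
    symSum q n z w = ikPrefactor q n z w * (ikMatrix q z w).det := by
  induction n with
  | zero => simp [symSum, geomChain, ikPrefactor, vandP]
  | succ n ih =>
    rw [symSum_succ]
    have hih : ∀ i j : Fin (n + 1), symSum q n (fun k => z (i.succAbove k))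
          (fun k => w (j.succAbove k))
        = ikPrefactor q n (fun k => z (i.succAbove k)) (fun k => w (j.succAbove k))
          * ((ikMatrix q z w).submatrix i.succAbove j.succAbove).det := fun i j =>
      ih _ _ (fun a b h => i.succAbove_right_injective (hz h))
        (fun a b h => j.succAbove_right_injective (hw h)) (fun _ _ => hzw _ _)
        (fun _ _ => hzqw _ _) (fun _ => hz1 _) (fun _ => hzq _) (fun _ => hw1 _)
        (fun _ => hwq _) (fun _ _ => hnorm _ _)
    have hzne : ∀ i, 1 - z i ≠ 0 := fun i => sub_ne_zero.2 (hz1 i).symm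
    have hwne : ∀ i, 1 - w i ≠ 0 := fun i => sub_ne_zero.2 (hw1 i).symm
    have hzne' : ∀ i, 1 - z i / q ≠ 0 := fun i => one_sub_div_ne_zero hq (hzq i)
    have hwne' : ∀ i, 1 - w i / q ≠ 0 := fun i => one_sub_div_ne_zero hq (hwq i)
    set R := (∏ k, (1 - w k) / (1 - w k / q)) / (∏ k, (1 - z k) / (1 - z k / q)) with hR
    have hR1 : 1 - R ≠ 0 := by
      rw [sub_ne_zero]
      intro h
      have := norm_prod_div_lt_one hnorm
      rw [← hR, ← h] at this
      simp at this
    have hterm : ∀ i j : Fin (n + 1),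
        (∏ k, (z i - q * z (i.succAbove k)) / (z i - z (i.succAbove k)))
        * (∏ k, (q * w j - w (j.succAbove k)) / (w j - w (j.succAbove k)))
        * ((∏ k, (1 - w (j.succAbove k)) / (1 - w (j.succAbove k) / q))
          / (∏ k, (1 - z (i.succAbove k)) / (1 - z (i.succAbove k) / q)))
        / (1 - R)
        * symSum q n (fun k => z (i.succAbove k)) (fun k => w (j.succAbove k))
        = ikPrefactor q (n + 1) z w * (R / (1 - R)) * ((1 / q - 1) * (-1) ^ n
          * (((∏ k, (z i - q * z (i.succAbove k))) / (∏ l, (z i - q * w l)) / (1 - z i / q))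
          * ((∏ k, (q * w j - w (j.succAbove k))) / (∏ k, (z k - q * w j)) / (1 - w j))
          * (z i - q * w j) * (ikMatrix q z w).adjugate j i)) := by
      intro i j
      rw [hih, Matrix.adjugate_fin_succ_eq_det_submatrix]
      have h1 := ikPrefactor_succAbove hq hq1 hz hw hzqw hz1 hwq i j
      have h2 : (∏ k, (1 - w (j.succAbove k)) / (1 - w (j.succAbove k) / q))
          / (∏ k, (1 - z (i.succAbove k)) / (1 - z (i.succAbove k) / q))
          = R * ((1 - z i) / (1 - z i / q)) / ((1 - w j) / (1 - w j / q)) := by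
        rw [hR, Fin.prod_univ_succAbove (fun k => (1 - w k) / (1 - w k / q)) j,
          Fin.prod_univ_succAbove (fun k => (1 - z k) / (1 - z k / q)) i]
        have h3 : (1 - z i) / (1 - z i / q) ≠ 0 := div_ne_zero (hzne i) (hzne' i)
        have h4 : (1 - w j) / (1 - w j / q) ≠ 0 := div_ne_zero (hwne j) (hwne' j)
        generalize (1 - z i) / (1 - z i / q) = a at *
        generalize (1 - w j) / (1 - w j / q) = b at *
        generalize (∏ k, (1 - z (i.succAbove k)) / (1 - z (i.succAbove k) / q)) = c
        generalize (∏ k, (1 - w (j.succAbove k)) / (1 - w (j.succAbove k) / q)) = d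
        rw [mul_div_mul_comm]
        field_simp
      rw [h2]
      calc _ = ((∏ k, (z i - q * z (i.succAbove k)) / (z i - z (i.succAbove k)))
            * (∏ k, (q * w j - w (j.succAbove k)) / (w j - w (j.succAbove k)))
            * ikPrefactor q n (fun k => z (i.succAbove k)) (fun k => w (j.succAbove k)))
            * (R * ((1 - z i) / (1 - z i / q)) / ((1 - w j) / (1 - w j / q)) / (1 - R)
            * ((ikMatrix q z w).submatrix i.succAbove j.succAbove).det) := by ring
        _ = _ := by
          rw [h1]
          have h3 := hzne i
          have h4 := hwne j
          have h5 := hwne' j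
          generalize 1 - w j / q = b at *
          generalize 1 - z i = a at *
          generalize 1 - w j = c at *
          generalize (∏ k, (z i - q * z (i.succAbove k))) / (∏ l, (z i - q * w l)) = U
          generalize (∏ k, (q * w j - w (j.succAbove k))) / (∏ k, (z k - q * w j)) = V
          field_simp
    simp only [hterm, ← mul_sum]
    rw [sum_adjugate_ikMatrix hq hz hw hzw hzqw hzq hw1]
    have hRinv : (∏ k, (1 - w k / q)) * (∏ k, (1 - z k))
        / ((∏ k, (1 - w k)) * ∏ k, (1 - z k / q)) = 1 / R := by
      rw [hR, prod_div_distrib, prod_div_distrib, div_div_div_eq, one_div_div]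
    have hR0 : R ≠ 0 := div_ne_zero (prod_ne_zero_iff.2 fun k _ => div_ne_zero (hwne k) (hwne' k))
      (prod_ne_zero_iff.2 fun k _ => div_ne_zero (hzne k) (hzne' k))
    rw [hRinv]
    field_simp

theorem one_div_mul_sub_eq {q a b : ℂ} (hq : q ≠ 0) (hq1 : q ≠ 1) (ha : a ≠ 0)
    (hab : a ≠ b) (haqb : a ≠ q * b) :
    1 / ((a - b) * (a - q * b)) = 1 / ((1 - q) * a) * (1 / (a - b) - 1 / (a / q - b)) := by
  have h1 := sub_ne_zero.2 hab
  have h2 := sub_ne_zero.2 haqb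
  have h3 : 1 - q ≠ 0 := sub_ne_zero.2 hq1.symm
  have h4 : a / q - b = (a - q * b) / q := by field_simp
  rw [h4, one_div_div, div_sub_div _ _ h1 h2, div_mul_div_comm, div_eq_div_iff
    (mul_ne_zero h1 h2) (mul_ne_zero (mul_ne_zero h3 ha) (mul_ne_zero h1 h2))]
  ring

open Finset Polynomial in
/-- The entries of the second determinant, expanded in the rows of the Izergin–Korepin matrix. -/
theorem second_entry_eq {q : ℂ} (hq : q ≠ 0) (hq1 : q ≠ 1) {n : ℕ} {w : Fin (n + 1) → ℂ}
    (hw : Function.Injective w) {x : ℂ} (hx : x ≠ 0) (hxw : ∀ j, x ≠ w j)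
    (hxqw : ∀ j, x ≠ q * w j) (m : Fin (n + 1)) :
    x ^ ((m : ℕ) + 1) * ((1 - 1 / x) * (1 - q / x) * ∏ l, (x - q * w l) / (x - w l)
        - q ^ (n + 1 - 1 - (m : ℕ)) * (1 - 1 / x) * (1 - q ^ 2 / x))
      = ((1 - q) * ((x - 1) * ∏ l, (x - q * w l))) * ∑ j, 1 / ((x - w j) * (x - q * w j))
        * ((w j - q) / (∏ k, (w j - w (j.succAbove k))) * w j ^ (m : ℕ)) := by
  have hy : ∀ j, x / q ≠ w j := fun j h => hxqw j (by rw [← h]; field_simp)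
  have h := lagrange_partial_fractions_sub hw (X ^ (m : ℕ) * (X - C q)) (by
    rw [degree_mul, degree_X_pow, degree_X_sub_C, Fintype.card_fin]
    exact_mod_cast m.2) hxw hy
  simp only [prod_univ_erase_succAbove, eval_mul, eval_pow, eval_X, eval_sub, eval_C] at h
  have hsum : ∑ j, 1 / ((x - w j) * (x - q * w j))
        * ((w j - q) / (∏ k, (w j - w (j.succAbove k))) * w j ^ (m : ℕ))
      = 1 / ((1 - q) * x) * (x ^ (m : ℕ) * (x - q) / ∏ l, (x - w l)
        - (x / q) ^ (m : ℕ) * (x / q - q) / ∏ l, (x / q - w l)) := by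
    rw [← h, mul_sum]
    refine sum_congr rfl fun j _ => ?_
    rw [one_div_mul_sub_eq hq hq1 hx (hxw j) (hxqw j)]
    ring
  have hscale : ∏ l, (x / q - w l) = (∏ l, (x - q * w l)) / q ^ (n + 1) := by
    rw [← prod_fin_div_const]
    exact prod_congr rfl fun k _ => by field_simp
  have hne1 : ∏ l, (x - q * w l) ≠ 0 := prod_ne_zero_iff.2 fun l _ => sub_ne_zero.2 (hxqw l)
  have hne2 : ∏ l, (x - w l) ≠ 0 := prod_ne_zero_iff.2 fun l _ => sub_ne_zero.2 (hxw l)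
  have h3 : 1 - q ≠ 0 := sub_ne_zero.2 hq1.symm
  have hpow : q ^ (n + 1) = q ^ (n + 1 - 1 - (m : ℕ)) * q ^ (m : ℕ) * q := by
    rw [← pow_add, ← pow_succ]
    congr 1
    have := m.2
    omega
  rw [hsum, hscale, prod_div_distrib, hpow, div_pow]
  generalize q ^ (n + 1 - 1 - (m : ℕ)) = Y
  field_simp
  ring

open Finset in
theorem prod_prod_succAbove {n : ℕ} (f : Fin (n + 1) → Fin (n + 1) → ℂ) :
    ∏ j, ∏ k, f j (j.succAbove k)
      = (∏ p ∈ univ.filter (fun p : Fin (n + 1) × Fin (n + 1) => p.1 < p.2), f p.1 p.2)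
        * ∏ p ∈ univ.filter (fun p : Fin (n + 1) × Fin (n + 1) => p.1 < p.2), f p.2 p.1 := by
  simp only [prod_filter, Fintype.prod_prod_type]
  rw [prod_comm (f := fun x y => if x < y then f y x else 1)]
  simp only [← prod_mul_distrib]
  refine prod_congr rfl fun j _ => ?_
  rw [Fin.prod_univ_succAbove (fun k => (if j < k then f j k else 1)
    * (if k < j then f j k else 1)) j]
  simp only [lt_irrefl, if_false, mul_one, one_mul]
  refine prod_congr rfl fun k _ => ?_
  rcases lt_or_gt_of_ne (Fin.succAbove_ne j k) with h | h
  · simp [h, h.not_gt]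
  · simp [h, h.not_gt]

open Finset in
theorem vandP_eq_sign_mul {n : ℕ} (z : Fin n → ℂ) :
    vandP z = (-1) ^ #(univ.filter fun p : Fin n × Fin n => p.1 < p.2)
      * (Matrix.vandermonde z).det := by
  rw [← prod_pairs_eq_det_vandermonde, ← prod_const, ← prod_mul_distrib, vandP]
  exact prod_congr rfl fun p _ => by ring

open Finset in
theorem ikPrefactor_mul_det_eq {q : ℂ} (hq : q ≠ 0) (hq1 : q ≠ 1) {n : ℕ}
    {z w : Fin (n + 1) → ℂ} (hw : Function.Injective w) (hz0 : ∀ i, z i ≠ 0)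
    (hzw : ∀ i j, z i ≠ w j) (hzqw : ∀ i j, z i ≠ q * w j) :
    ikPrefactor q (n + 1) z w * (ikMatrix q z w).det
      = (1 - q) ^ (-(2 * ((n + 1 : ℕ) : ℤ))) / (Matrix.vandermonde z).det
        * Matrix.det (Matrix.of fun i j : Fin (n + 1) => z j ^ ((i : ℕ) + 1)
          * ((1 - 1 / z j) * (1 - q / z j) * ∏ l, (z j - q * w l) / (z j - w l)
            - q ^ (n + 1 - 1 - (i : ℕ)) * (1 - 1 / z j) * (1 - q ^ 2 / z j))) := by
  have hmat : (Matrix.of fun i j : Fin (n + 1) => z j ^ ((i : ℕ) + 1)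
          * ((1 - 1 / z j) * (1 - q / z j) * ∏ l, (z j - q * w l) / (z j - w l)
            - q ^ (n + 1 - 1 - (i : ℕ)) * (1 - 1 / z j) * (1 - q ^ 2 / z j)))
      = (Matrix.diagonal (fun i => (1 - q) * ((z i - 1) * ∏ l, (z i - q * w l)))
          * (ikMatrix q z w
            * (Matrix.diagonal (fun j => (w j - q) / (∏ k, (w j - w (j.succAbove k))))
              * Matrix.vandermonde w))).transpose := by
    ext i j
    rw [Matrix.of_apply, second_entry_eq hq hq1 hw (hz0 j) (hzw j) (hzqw j), Matrix.transpose_apply,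
      Matrix.diagonal_mul, Matrix.mul_apply]
    simp [Matrix.diagonal_mul, ikMatrix, Matrix.vandermonde_apply]
  have hvw : ∏ j, ∏ k, (w j - w (j.succAbove k)) = vandP w * (Matrix.vandermonde w).det := by
    rw [prod_prod_succAbove fun a b => w a - w b, prod_pairs_eq_det_vandermonde, vandP]
  have hW : (Matrix.vandermonde w).det ≠ 0 := Matrix.det_vandermonde_ne_zero_iff.2 hw
  have h3 : 1 - q ≠ 0 := sub_ne_zero.2 hq1.symm
  have hz' : ∏ j, (1 - z j) * (1 - w j / q)
      = (∏ j, (z j - 1)) * (∏ j, (w j - q)) / q ^ (n + 1) := by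
    rw [← prod_mul_distrib, ← prod_fin_div_const]
    exact prod_congr rfl fun k _ => by field_simp; ring
  have hpow : (1 / q - 1) ^ (-((n + 1 : ℕ) : ℤ)) = q ^ (n + 1) / (1 - q) ^ (n + 1) := by
    have h : 1 / q - 1 = (1 - q) / q := by field_simp
    rw [zpow_neg, zpow_natCast, h, div_pow, inv_div]
  have hpow2 : (1 - q) ^ (-(2 * ((n + 1 : ℕ) : ℤ)))
      = 1 / ((1 - q) ^ (n + 1) * (1 - q) ^ (n + 1)) := by
    rw [zpow_neg, two_mul, zpow_add₀ h3, zpow_natCast, one_div]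
  rw [hmat, Matrix.det_transpose, Matrix.det_mul, Matrix.det_mul, Matrix.det_mul,
    Matrix.det_diagonal, Matrix.det_diagonal, prod_div_distrib, hvw, prod_fin_const_mul,
    prod_mul_distrib, ikPrefactor, hz', hpow, hpow2, vandP_eq_sign_mul, vandP_eq_sign_mul]
  have h4 := pow_ne_zero (n + 1) h3
  have h5 := pow_ne_zero (n + 1) hq
  generalize (1 - q) ^ (n + 1) = y at *
  generalize (Matrix.vandermonde w).det = vw at *
  generalize (Matrix.vandermonde z).det = vz at *
  rcases neg_one_pow_eq_or ℂ #(univ.filter fun p : Fin (n + 1) × Fin (n + 1) => p.1 < p.2)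
    with hs | hs <;> rw [hs] <;> field_simp

/-- Increasing sequences of non-negative integers are increasing sequences of naturals. -/
def strictMonoNonnegEquiv (n : ℕ) :
    {y : Fin n → ℕ // StrictMono y} ≃ {x : Fin n → ℤ // StrictMono x ∧ ∀ i, 0 ≤ x i} where
  toFun y := ⟨fun i => (y.1 i : ℤ), fun i j h => Int.ofNat_lt.2 (y.2 h),
    fun i => Int.natCast_nonneg _⟩
  invFun x := ⟨fun i => (x.1 i).toNat, fun i j h => by
    have h1 := x.2.1 h
    have h2 := x.2.2 i
    simp only
    omega⟩
  left_inv y := Subtype.ext (funext fun i => by simp)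
  right_inv x := Subtype.ext (funext fun i => by simpa using x.2.2 i)

open Finset in
theorem PsiR_mul_PsiL_natCast (q : ℂ) {n : ℕ} (z w : Fin n → ℂ) (y : Fin n → ℕ) :
    PsiR q (fun i => (y i : ℤ)) z * PsiL q (fun i => (y i : ℤ)) w
      = ∑ σ : Equiv.Perm (Fin n), ∑ τ : Equiv.Perm (Fin n),
        (∏ p ∈ univ.filter (fun p : Fin n × Fin n => p.1 < p.2),
          (z (σ p.1) - q * z (σ p.2)) / (z (σ p.1) - z (σ p.2)))
        * (∏ p ∈ univ.filter (fun p : Fin n × Fin n => p.1 < p.2),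
          (q * w (τ p.1) - w (τ p.2)) / (w (τ p.1) - w (τ p.2)))
        * ∏ i, (((1 - w (τ i)) / (1 - w (τ i) / q))
          / ((1 - z (σ i)) / (1 - z (σ i) / q))) ^ y i := by
  rw [PsiR, PsiL, sum_mul_sum]
  refine sum_congr rfl fun σ _ => sum_congr rfl fun τ _ => ?_
  rw [mul_mul_mul_comm, ← prod_mul_distrib (s := univ (α := Fin n))]
  congr 1
  refine prod_congr rfl fun i _ => ?_
  rw [zpow_neg, zpow_natCast, zpow_natCast, ← inv_pow, ← mul_pow, ← div_eq_inv_mul]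

open Finset in
theorem hasSum_PsiR_mul_PsiL {q : ℂ} {n : ℕ} {z w : Fin n → ℂ}
    (hnorm : ∀ i j, ‖((1 - w j) / (1 - w j / q)) / ((1 - z i) / (1 - z i / q))‖ < 1) :
    Summable (fun x : {x : Fin n → ℤ // StrictMono x ∧ ∀ i, 0 ≤ x i} =>
        ‖PsiR q x.1 z * PsiL q x.1 w‖)
      ∧ HasSum (fun x : {x : Fin n → ℤ // StrictMono x ∧ ∀ i, 0 ≤ x i} =>
        PsiR q x.1 z * PsiL q x.1 w) (symSum q n z w) := by
  have hg := fun σ τ : Equiv.Perm (Fin n) => hasSum_geomChain n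
    (fun i => ((1 - w (τ i)) / (1 - w (τ i) / q)) / ((1 - z (σ i)) / (1 - z (σ i) / q)))
    fun i => hnorm (σ i) (τ i)
  rw [← (strictMonoNonnegEquiv n).summable_iff, ← (strictMonoNonnegEquiv n).hasSum_iff]
  simp only [Function.comp_def, strictMonoNonnegEquiv, Equiv.coe_fn_mk, PsiR_mul_PsiL_natCast]
  refine ⟨Summable.of_nonneg_of_le (fun _ => norm_nonneg _) (fun y => (norm_sum_le _ _).trans
    (sum_le_sum fun σ _ => norm_sum_le _ _)) (summable_sum fun σ _ => summable_sum fun τ _ => ?_),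
    hasSum_sum fun σ _ => hasSum_sum fun τ _ => (hg σ τ).2.mul_left _⟩
  simp only [norm_mul]
  exact (hg σ τ).1.mul_left _

/-- Summation identity for ASEP eigenfunctions (Corollary 7.1). -/
theorem asep_eigenfunction_summation
    (N : ℕ) (hN : 1 ≤ N)
    (q : ℝ) (hq0 : 0 < q) (hq1 : q < 1)
    (z w : Fin N → ℂ) (hz : Function.Injective z) (hw : Function.Injective w)
    (hz1 : ∀ i, z i ≠ 1) (hzq : ∀ i, z i ≠ (q : ℂ))
    (hw1 : ∀ j, w j ≠ 1) (hwq : ∀ j, w j ≠ (q : ℂ))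
    (hzw : ∀ i j : Fin N, z i ≠ w j) (hzqw : ∀ i j : Fin N, z i ≠ (q : ℂ) * w j)
    (hnorm : ∀ i j : Fin N,
      ‖(1 - w j) * (1 - z i / q)‖ < ‖(1 - z i) * (1 - w j / q)‖) :
    Summable (fun x : {x : Fin N → ℤ // StrictMono x ∧ ∀ i, 0 ≤ x i} =>
      ‖PsiR (q : ℂ) x.1 z * PsiL (q : ℂ) x.1 w‖)
    ∧ (∑' x : {x : Fin N → ℤ // StrictMono x ∧ ∀ i, 0 ≤ x i},
        PsiR (q : ℂ) x.1 z * PsiL (q : ℂ) x.1 w)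
      = (∏ j : Fin N, (1 - z j) * (1 - w j / q))
          * (1 / (q : ℂ) - 1) ^ (-(N : ℤ))
          * ((∏ i : Fin N, ∏ j : Fin N, (z i - (q : ℂ) * w j))
              / (vandP z * ∏ p ∈ Finset.univ.filter (fun p : Fin N × Fin N => p.1 < p.2),
                  (w p.2 - w p.1)))
          * Matrix.det (Matrix.of fun i j : Fin N =>
              1 / ((z i - w j) * (z i - (q : ℂ) * w j)))
    ∧ ((∀ j, z j ≠ 0) →
        (∑' x : {x : Fin N → ℤ // StrictMono x ∧ ∀ i, 0 ≤ x i},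
          PsiR (q : ℂ) x.1 z * PsiL (q : ℂ) x.1 w)
        = (1 - (q : ℂ)) ^ (-(2 * (N : ℤ)))
            / (∏ p ∈ Finset.univ.filter (fun p : Fin N × Fin N => p.1 < p.2),
                (z p.2 - z p.1))
            * Matrix.det (Matrix.of fun i j : Fin N =>
                z j ^ ((i : ℕ) + 1)
                  * ((1 - 1 / z j) * (1 - (q : ℂ) / z j)
                        * ∏ l : Fin N, (z j - (q : ℂ) * w l) / (z j - w l)
                      - (q : ℂ) ^ (N - 1 - (i : ℕ))
                          * (1 - 1 / z j) * (1 - (q : ℂ) ^ 2 / z j)))) := by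
  have hQ : (q : ℂ) ≠ 0 := Complex.ofReal_ne_zero.2 hq0.ne'
  have hQ1 : (q : ℂ) ≠ 1 := Complex.ofReal_ne_one.2 hq1.ne
  have hratio : ∀ i j, ‖((1 - w j) / (1 - w j / (q : ℂ)))
      / ((1 - z i) / (1 - z i / (q : ℂ)))‖ < 1 := by
    intro i j
    have h := hnorm i j
    rw [div_div_div_eq, mul_comm (1 - w j / (q : ℂ)), norm_div,
      div_lt_one ((norm_nonneg _).trans_lt h)]
    exact h
  obtain ⟨hs, hsum⟩ := hasSum_PsiR_mul_PsiL hratio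
  rw [hsum.tsum_eq, symSum_eq_det hQ hQ1 N z w hz hw hzw hzqw hz1 hzq hw1 hwq hratio]
  refine ⟨hs, ?_, fun hz0 => ?_⟩
  · rw [prod_pairs_eq_det_vandermonde, ikPrefactor, ikMatrix]
  · obtain ⟨n, rfl⟩ := Nat.exists_eq_add_of_le' hN
    rw [prod_pairs_eq_det_vandermonde]
    exact ikPrefactor_mul_det_eq hQ hQ1 hw hz0 hzw hzqw
end
end

section
/- Shift invariance of the ASEP eigenfunction sum (Lemma 7.2). Let N ≥ 1 and q ∈ (0,1). Let z_1,…,z_N be pairwise distinct and w_1,…,w_N be pairwise distinct complex numbers with z_i, w_j ∉ {1, q} for all i,j, and suppose |(1−w_j)(1−z_i/q)| < |(1−z_i)(1−w_j/q)| for all 1 ≤ i,j ≤ N. Then for every integer k the family Ψ^r_x(z)·Ψ^ℓ_x(w) indexed by integer vectors x with k ≤ x_1 < x_2 < … < x_N is absolutely summable, and Σ_{k≤x_1<…<x_N} Ψ^r_x(z) Ψ^ℓ_x(w) = ∏_{j=1}^N [ (1−w_j)(1−z_j/q) / ((1−z_j)(1−w_j/q)) ]^{k} · Σ_{0≤x_1<…<x_N}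 Ψ^r_x(z) Ψ^ℓ_x(w). -/
open scoped BigOperators

noncomputable section

theorem summable_prod_pi_of_nonneg {ι κ : Type*} [Fintype ι] {f : ι → κ → ℝ}
    (hf : ∀ i n, 0 ≤ f i n) (hs : ∀ i, Summable (f i)) :
    Summable (fun x : ι → κ => ∏ i, f i (x i)) := by
  classical
  refine summable_of_sum_le (c := ∏ i, ∑' n, f i n)
    (fun x => Finset.prod_nonneg fun i _ => hf i _) fun u => ?_
  calc ∑ x ∈ u, ∏ i, f i (x i)
      ≤ ∑ x ∈ Fintype.piFinset (fun i => u.image (fun x => x i)), ∏ i, f i (x i) := by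
        refine Finset.sum_le_sum_of_subset_of_nonneg (fun x hx => ?_)
          fun x _ _ => Finset.prod_nonneg fun i _ => hf i _
        exact Fintype.mem_piFinset.2 fun i => Finset.mem_image_of_mem (fun x => x i) hx
    _ = ∏ i, ∑ n ∈ u.image (fun x => x i), f i n := (Finset.prod_univ_sum _ _).symm
    _ ≤ ∏ i, ∑' n, f i n :=
        Finset.prod_le_prod (fun i _ => Finset.sum_nonneg fun n _ => hf i n)
          fun i _ => (hs i).sum_le_tsum _ fun n _ => hf i n

theorem summable_norm_prod_zpow_of_le {ι : Type*} [Fintype ι] {c : ι → ℂ} (h0 : ∀ i, c i ≠ 0)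
    (h1 : ∀ i, ‖c i‖ < 1) (k : ℤ) (P : (ι → ℤ) → Prop) :
    Summable (fun x : {x : ι → ℤ // P x ∧ ∀ i, k ≤ x i} => ‖∏ i, c i ^ x.1 i‖) := by
  have hs : Summable (fun n : ι → ℕ => ∏ i, ‖c i‖ ^ n i) :=
    summable_prod_pi_of_nonneg (f := fun i n => ‖c i‖ ^ n) (fun i n => by positivity)
      fun i => summable_geometric_of_lt_one (norm_nonneg _) (h1 i)
  have hinj : Function.Injective
      (fun (x : {x : ι → ℤ // P x ∧ ∀ i, k ≤ x i}) (i : ι) => (x.1 i - k).toNat) := by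
    intro x y hxy
    ext i
    have := congrFun hxy i
    have hx := x.2.2 i
    have hy := y.2.2 i
    simp only at this
    omega
  refine ((hs.comp_injective hinj).mul_left (∏ i, ‖c i‖ ^ k)).congr fun x => ?_
  simp only [Function.comp_apply, norm_prod, norm_zpow, ← Finset.prod_mul_distrib]
  refine Finset.prod_congr rfl fun i _ => ?_
  have hx := x.2.2 i
  rw [← zpow_natCast, ← zpow_add₀ (norm_ne_zero_iff.2 (h0 i))]
  congr 1
  omega

theorem prod_zpow_add_const_perm {ι : Type*} [Fintype ι] {c : ι → ℂ} (h0 : ∀ i, c i ≠ 0)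
    (σ : Equiv.Perm ι) (x : ι → ℤ) (k : ℤ) :
    ∏ i, c (σ i) ^ (x i + k) = (∏ i, c i) ^ k * ∏ i, c (σ i) ^ x i := by
  simp_rw [zpow_add₀ (h0 _), Finset.prod_mul_distrib, Finset.prod_zpow, Equiv.prod_comp σ c]
  ring

theorem PsiR_add_const (q : ℂ) {N : ℕ} (x : Fin N → ℤ) {z : Fin N → ℂ} (k : ℤ)
    (h0 : ∀ i, (1 - z i) / (1 - z i / q) ≠ 0) :
    PsiR q (fun i => x i + k) z
      = (∏ i, (1 - z i) / (1 - z i / q)) ^ (-k) * PsiR q x z := by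
  unfold PsiR
  rw [Finset.mul_sum]
  refine Finset.sum_congr rfl fun σ _ => ?_
  simp_rw [neg_add]
  rw [prod_zpow_add_const_perm h0 σ (fun i => -x i)]
  ring

theorem PsiL_add_const (q : ℂ) {N : ℕ} (x : Fin N → ℤ) {z : Fin N → ℂ} (k : ℤ)
    (h0 : ∀ i, (1 - z i) / (1 - z i / q) ≠ 0) :
    PsiL q (fun i => x i + k) z
      = (∏ i, (1 - z i) / (1 - z i / q)) ^ k * PsiL q x z := by
  unfold PsiL
  rw [Finset.mul_sum]
  refine Finset.sum_congr rfl fun σ _ => ?_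
  rw [prod_zpow_add_const_perm h0 σ x]
  ring

theorem summable_norm_PsiR_mul_PsiL (q : ℂ) {N : ℕ} {z w : Fin N → ℂ}
    (hz : ∀ i, (1 - z i) / (1 - z i / q) ≠ 0) (hw : ∀ i, (1 - w i) / (1 - w i / q) ≠ 0)
    (h : ∀ i j, ‖((1 - z i) / (1 - z i / q))⁻¹ * ((1 - w j) / (1 - w j / q))‖ < 1)
    (k : ℤ) (P : (Fin N → ℤ) → Prop) :
    Summable (fun x : {x : Fin N → ℤ // P x ∧ ∀ i, k ≤ x i} =>
      ‖PsiR q x.1 z * PsiL q x.1 w‖) := by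
  simp only [PsiR, PsiL, Finset.sum_mul_sum]
  refine Summable.norm ?_
  refine summable_sum fun σ _ => summable_sum fun τ _ => ?_
  refine ((summable_norm_prod_zpow_of_le
    (fun i => mul_ne_zero (inv_ne_zero (hz (σ i))) (hw (τ i)))
    (fun i => h (σ i) (τ i)) k P).of_norm.mul_left
      ((∏ p ∈ Finset.univ.filter (fun p : Fin N × Fin N => p.1 < p.2),
        (z (σ p.1) - q * z (σ p.2)) / (z (σ p.1) - z (σ p.2))) *
      ∏ p ∈ Finset.univ.filter (fun p : Fin N × Fin N => p.1 < p.2),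
        (q * w (τ p.1) - w (τ p.2)) / (w (τ p.1) - w (τ p.2)))).congr fun x => ?_
  simp_rw [mul_zpow, Finset.prod_mul_distrib, inv_zpow, ← zpow_neg]
  ring

/-- Translation by the constant vector `k`, from strictly increasing vectors with nonnegative
entries to those with entries at least `k`. -/
def strictMonoShiftEquiv (N : ℕ) (k : ℤ) :
    {x : Fin N → ℤ // StrictMono x ∧ ∀ i, (0 : ℤ) ≤ x i} ≃
      {x : Fin N → ℤ // StrictMono x ∧ ∀ i, k ≤ x i} where
  toFun x := ⟨fun i => x.1 i + k, fun _ _ hij => by simpa using x.2.1 hij,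
    fun i => by simpa using x.2.2 i⟩
  invFun x := ⟨fun i => x.1 i - k, fun _ _ hij => by simpa using x.2.1 hij,
    fun i => by simpa using x.2.2 i⟩
  left_inv x := by ext; simp
  right_inv x := by ext; simp

/-- Shift invariance of the ASEP eigenfunction sum (Lemma 7.2). -/
theorem asep_sum_shift_invariance
    (N : ℕ) (hN : 1 ≤ N)
    (q : ℝ) (hq0 : 0 < q) (hq1 : q < 1)
    (z w : Fin N → ℂ) (hz : Function.Injective z) (hw : Function.Injective w)
    (hz1 : ∀ i, z i ≠ 1) (hzq : ∀ i, z i ≠ (q : ℂ))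
    (hw1 : ∀ j, w j ≠ 1) (hwq : ∀ j, w j ≠ (q : ℂ))
    (hnorm : ∀ i j : Fin N,
      ‖(1 - w j) * (1 - z i / q)‖ < ‖(1 - z i) * (1 - w j / q)‖)
    (k : ℤ) :
    Summable (fun x : {x : Fin N → ℤ // StrictMono x ∧ ∀ i, k ≤ x i} =>
      ‖PsiR (q : ℂ) x.1 z * PsiL (q : ℂ) x.1 w‖)
    ∧ (∑' x : {x : Fin N → ℤ // StrictMono x ∧ ∀ i, k ≤ x i},
        PsiR (q : ℂ) x.1 z * PsiL (q : ℂ) x.1 w)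
      = (∏ j : Fin N,
          (1 - w j) * (1 - z j / q) / ((1 - z j) * (1 - w j / q))) ^ k
          * ∑' x : {x : Fin N → ℤ // StrictMono x ∧ ∀ i, (0 : ℤ) ≤ x i},
              PsiR (q : ℂ) x.1 z * PsiL (q : ℂ) x.1 w := by
  have hqc : (q : ℂ) ≠ 0 := by exact_mod_cast hq0.ne'
  have hfac : ∀ u : ℂ, u ≠ 1 → u ≠ q → 1 - u ≠ 0 ∧ 1 - u / q ≠ 0 := fun u h1 h2 =>
    ⟨sub_ne_zero.2 h1.symm, sub_ne_zero.2 fun h => h2 (by field_simp at h; exact h.symm)⟩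
  have hzf := fun i => hfac (z i) (hz1 i) (hzq i)
  have hwf := fun j => hfac (w j) (hw1 j) (hwq j)
  have hz0 : ∀ i, (1 - z i) / (1 - z i / (q : ℂ)) ≠ 0 := fun i => div_ne_zero (hzf i).1 (hzf i).2
  have hw0 : ∀ i, (1 - w i) / (1 - w i / (q : ℂ)) ≠ 0 := fun i => div_ne_zero (hwf i).1 (hwf i).2
  refine ⟨summable_norm_PsiR_mul_PsiL q hz0 hw0 (fun i j => ?_) k StrictMono, ?_⟩
  · have hpos : 0 < ‖(1 - z i) * (1 - w j / (q : ℂ))‖ :=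
      norm_pos_iff.2 (mul_ne_zero (hzf i).1 (hwf j).2)
    rw [inv_div, div_mul_div_comm, norm_div, div_lt_one hpos, mul_comm (1 - z i / (q : ℂ))]
    exact hnorm i j
  · rw [← (strictMonoShiftEquiv N k).tsum_eq, ← tsum_mul_left]
    refine tsum_congr fun x => ?_
    change PsiR (q : ℂ) (fun i => x.1 i + k) z * PsiL (q : ℂ) (fun i => x.1 i + k) w = _
    have hprod : (∏ j, (1 - w j) * (1 - z j / (q : ℂ)) / ((1 - z j) * (1 - w j / (q : ℂ))))
        = (∏ j, (1 - z j) / (1 - z j / (q : ℂ)))⁻¹ * ∏ j, (1 - w j) / (1 - w j / (q : ℂ)) := by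
      rw [← Finset.prod_inv_distrib, ← Finset.prod_mul_distrib]
      refine Finset.prod_congr rfl fun j _ => ?_
      rw [inv_div, div_mul_div_comm, mul_comm (1 - w j)]
    rw [PsiR_add_const _ _ _ hz0, PsiL_add_const _ _ _ hw0, hprod, mul_zpow, inv_zpow, ← zpow_neg]
    ring
end
end
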